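/- arXiv:2002.08644 — 2 statements merged into one kernel-verified Lean document; each statement's English description precedes it below -/
import Mathlib

section
/- Let D ⊆ ℂ be a generalized Jordan domain and let φ : D → Ω be a homeomorphism of D onto a bounded domain Ω ⊆ ℂ that admits a continuous extension φ̄ : closure(D) → closure(Ω). Then: (i) for every connected component Q of ∂D, the restriction of φ̄ to Q, as a map from Q onto φ̄(Q), is non-alternating; (ii) φ̄ is monotone (i.e., the preimage under φ̄ of every point of closure(Ω) is connected) if and only if Ω is a generalized Jordan domain. -/
open Set Metric Filter MeasureTheory Topology

noncomputable section

/-- A planar domain: a nonempty open connected subset of ℂ. -/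
def IsPlanarDomain (D : Set ℂ) : Prop := D.Nonempty ∧ IsOpen D ∧ IsConnected D

/-- A Peano compactum: a compact subset of ℂ all of whose connected components are
locally connected (as subspaces of ℂ) and such that for every `C > 0` only finitely
many components have diameter greater than `C`. -/
def IsPeanoCompactum (K : Set ℂ) : Prop :=
  IsCompact K ∧
  (∀ x ∈ K, LocallyConnectedSpace ↥(connectedComponentIn K x)) ∧
  ∀ C : ℝ, 0 < C →
    {Q : Set ℂ | (∃ x ∈ K, Q = connectedComponentIn K x) ∧ C < Metric.diam Q}.Finite

/-- A Jordan curve: a subset of ℂ homeomorphic to the unit circle. -/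
def IsJordanCurve (J : Set ℂ) : Prop :=
  Nonempty (↥J ≃ₜ ↥(Metric.sphere (0:ℂ) 1))

/-- A generalized Jordan domain: a bounded domain whose boundary is a Peano compactum,
each of whose boundary components is a single point or a Jordan curve. -/
def IsGeneralizedJordanDomain (D : Set ℂ) : Prop :=
  IsPlanarDomain D ∧ Bornology.IsBounded D ∧
  IsPeanoCompactum (frontier D) ∧
  ∀ x ∈ frontier D,
    connectedComponentIn (frontier D) x = {x} ∨
    IsJordanCurve (connectedComponentIn (frontier D) x)

/-- `φ` restricts to a homeomorphism of `D` onto `Ω`. -/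
def IsHomeoOnto (φ : ℂ → ℂ) (D Ω : Set ℂ) : Prop :=
  ContinuousOn φ D ∧ Set.BijOn φ D Ω ∧
  ∃ ψ : ℂ → ℂ, ContinuousOn ψ Ω ∧ Set.InvOn ψ φ D Ω

/-- `φ` is a conformal homeomorphism (holomorphic bijection) of `D` onto `Ω`. -/
def IsConformalHomeoOnto (φ : ℂ → ℂ) (D Ω : Set ℂ) : Prop :=
  DifferentiableOn ℂ φ D ∧ Set.BijOn φ D Ω

/-- `φb` is a continuous extension of `φ : D → Ω` to `closure D`, with values in `closure Ω`. -/
def ExtendsContinuously (φ φb : ℂ → ℂ) (D Ω : Set ℂ) : Prop :=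
  ContinuousOn φb (closure D) ∧ Set.EqOn φb φ D ∧ Set.MapsTo φb (closure D) (closure Ω)

/-- The oscDiam `σ_r(z₀) = diam φ(D ∩ C_r(z₀))`. -/
def oscDiam (φ : ℂ → ℂ) (D : Set ℂ) (z₀ : ℂ) (r : ℝ) : ℝ :=
  Metric.diam (φ '' (D ∩ Metric.sphere z₀ r))

/-- `liminf_{r→0⁺} σ_r(z₀) = 0`. -/
def OscLiminfZero (φ : ℂ → ℂ) (D : Set ℂ) (z₀ : ℂ) : Prop :=
  Filter.liminf (oscDiam φ D z₀) (nhdsWithin (0:ℝ) (Set.Ioi 0)) = 0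

/-- A circle domain (normalized so that ∞ lies in a complementary disk): every bounded
complementary component is a point or a closed round disk, and the unbounded
complementary component is the complement of an open round disk. -/
def IsCircleDomain (D : Set ℂ) : Prop :=
  IsPlanarDomain D ∧ Bornology.IsBounded D ∧
  ∀ x ∈ Dᶜ,
    (Bornology.IsBounded (connectedComponentIn Dᶜ x) →
      connectedComponentIn Dᶜ x = {x} ∨
      ∃ c : ℂ, ∃ rad : ℝ, 0 < rad ∧ connectedComponentIn Dᶜ x = Metric.closedBall c rad) ∧
    (¬ Bornology.IsBounded (connectedComponentIn Dᶜ x) →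
      ∃ c : ℂ, ∃ rad : ℝ, 0 < rad ∧ connectedComponentIn Dᶜ x = (Metric.ball c rad)ᶜ)

/-- A set has σ-finite linear (1-dimensional Hausdorff) measure. -/
def SigmaFiniteH1 (E : Set ℂ) : Prop :=
  ∃ f : ℕ → Set ℂ, (⋃ n, f n) = E ∧ ∀ n, μH[1] (f n) < ⊤

/-- The set of connected components of `K` containing more than one point. -/
def NondegComponents (K : Set ℂ) : Set (Set ℂ) :=
  {Q | (∃ x ∈ K, Q = connectedComponentIn K x) ∧ ∃ a ∈ Q, ∃ b ∈ Q, a ≠ b}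

/-- The union of the singleton connected components of `K`. -/
def SingletonPart (K : Set ℂ) : Set ℂ :=
  {x | x ∈ K ∧ connectedComponentIn K x = {x}}

/-- The cluster set `C(h, z₀) = ⋂_{r>0} closure h({z ∈ U : |z − z₀| < r})`. -/
def clusterSet (h : ℂ → ℂ) (U : Set ℂ) (z₀ : ℂ) : Set ℂ :=
  ⋂ r ∈ Set.Ioi (0:ℝ), closure (h '' (U ∩ Metric.ball z₀ r))

/-- The boundary component of `Ω` corresponding (under `φ : D → Ω`) to a boundary
component `Q` of `D`: `φ^B(Q) = ⋃_{z ∈ Q} C(φ, z)`. -/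
def boundaryComp (φ : ℂ → ℂ) (D : Set ℂ) (Q : Set ℂ) : Set ℂ :=
  ⋃ z ∈ Q, clusterSet φ D z

/-- An arc: the image of a continuous injective map from `[0,1]`. -/
def IsArc (A : Set ℂ) : Prop :=
  ∃ f : ℝ → ℂ, ContinuousOn f (Set.Icc 0 1) ∧ Set.InjOn f (Set.Icc 0 1) ∧
    f '' Set.Icc 0 1 = A

/-- An arc from `a` to `b`. -/
def IsArcFromTo (A : Set ℂ) (a b : ℂ) : Prop :=
  ∃ f : ℝ → ℂ, ContinuousOn f (Set.Icc 0 1) ∧ Set.InjOn f (Set.Icc 0 1) ∧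
    f '' Set.Icc 0 1 = A ∧ f 0 = a ∧ f 1 = b

/-- Property S: for every `ε > 0`, `Ω` is a finite union of connected sets of diameter `< ε`. -/
def PropertyS (Ω : Set ℂ) : Prop :=
  ∀ ε > (0:ℝ), ∃ (k : ℕ) (N : Fin k → Set ℂ),
    (∀ i, IsConnected (N i) ∧ Metric.diam (N i) < ε) ∧ (⋃ i, N i) = Ω

/-- `x ∈ ∂Ω` is locally accessible from `Ω`. -/
def LocallyAccessible (Ω : Set ℂ) (x : ℂ) : Prop :=
  ∀ ε > (0:ℝ), ∃ δ > (0:ℝ), ∀ z ∈ Ω, dist z x < δ →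
    ∃ A : Set ℂ, IsArcFromTo A z x ∧ A ⊆ Ω ∪ {x} ∧ Metric.diam A < ε

/-- `ξ ∈ ∂Ω` is locally sequentially accessible. -/
def LocallySeqAccessible (Ω : Set ℂ) (ξ : ℂ) : Prop :=
  ∀ r > (0:ℝ), ∀ ξn : ℕ → ℂ, (∀ n, ξn n ∈ Ω) → Filter.Tendsto ξn Filter.atTop (nhds ξ) →
    ∃ x ∈ Ω ∩ Metric.ball ξ r,
      {n : ℕ | ξn n ∈ connectedComponentIn (Ω ∩ Metric.ball ξ r) x}.Infinite

/-- `Ω` is finitely connected at the boundary point `x`. -/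
def FinitelyConnectedAt (Ω : Set ℂ) (x : ℂ) : Prop :=
  ∀ r > (0:ℝ), ∃ U : Set ℂ, IsOpen U ∧ x ∈ U ∧ U ⊆ Metric.ball x r ∧
    {Q : Set ℂ | ∃ y ∈ U ∩ Ω, Q = connectedComponentIn (U ∩ Ω) y}.Finite

/-- The diameter (Mazurkiewicz) distance on `Ω`. -/
def mazDist (Ω : Set ℂ) (x y : ℂ) : ℝ :=
  sInf (Metric.diam '' {E : Set ℂ | E ⊆ Ω ∧ IsConnected E ∧ x ∈ E ∧ y ∈ E})

/-- `Ω` is totally bounded for the Mazurkiewicz distance; for a metric space this is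
equivalent to compactness of the metric completion of `(Ω, mazDist)`. -/
def MazCompletionCompact (Ω : Set ℂ) : Prop :=
  ∀ ε > (0:ℝ), ∃ F : Finset ℂ, ↑F ⊆ Ω ∧ ∀ x ∈ Ω, ∃ y ∈ F, mazDist Ω x y < ε

/-- `f : A → B` is non-alternating: there are no `x, y ∈ B` and no separation of
`A \ f⁻¹({x})` into two disjoint nonempty relatively open sets `A₁, A₂` with
`y ∈ f(A₁) ∩ f(A₂)`. -/
def NonAlternatingOn (f : ℂ → ℂ) (A B : Set ℂ) : Prop :=
  ¬ ∃ x ∈ B, ∃ y ∈ B, ∃ A₁ A₂ : Set ℂ,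
      A₁.Nonempty ∧ A₂.Nonempty ∧ Disjoint A₁ A₂ ∧
      A₁ ∪ A₂ = {z | z ∈ A ∧ f z ≠ x} ∧
      (∃ U₁ : Set ℂ, IsOpen U₁ ∧ A₁ = U₁ ∩ {z | z ∈ A ∧ f z ≠ x}) ∧
      (∃ U₂ : Set ℂ, IsOpen U₂ ∧ A₂ = U₂ ∩ {z | z ∈ A ∧ f z ≠ x}) ∧
      y ∈ f '' A₁ ∧ y ∈ f '' A₂

/-- `g` has a continuous logarithm on `X`. -/
def HasLogOn (g : ℂ → ℂ) (X : Set ℂ) : Prop :=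
  ∃ L : ℂ → ℂ, ContinuousOn L X ∧ ∀ z ∈ X, Complex.exp (L z) = g z

namespace HasLogOn

variable {g h : ℂ → ℂ} {X Y : Set ℂ}

theorem mono (hg : HasLogOn g Y) (hXY : X ⊆ Y) : HasLogOn g X := by
  obtain ⟨L, hL, hLg⟩ := hg
  exact ⟨L, hL.mono hXY, fun z hz => hLg z (hXY hz)⟩

theorem congr (hg : HasLogOn g X) (hgh : EqOn g h X) : HasLogOn h X := by
  obtain ⟨L, hL, hLg⟩ := hg
  exact ⟨L, hL, fun z hz => (hLg z hz).trans (hgh hz)⟩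

theorem mul (hg : HasLogOn g X) (hh : HasLogOn h X) : HasLogOn (fun z => g z * h z) X := by
  obtain ⟨L, hL, hLg⟩ := hg
  obtain ⟨M, hM, hMh⟩ := hh
  exact ⟨fun z => L z + M z, hL.add hM, fun z hz => by rw [Complex.exp_add, hLg z hz, hMh z hz]⟩

theorem inv (hg : HasLogOn g X) : HasLogOn (fun z => (g z)⁻¹) X := by
  obtain ⟨L, hL, hLg⟩ := hg
  exact ⟨fun z => -L z, hL.neg, fun z hz => by rw [Complex.exp_neg, hLg z hz]⟩

end HasLogOn

/-- Two continuous logarithms of the same function differ by a constant on a preconnected set. -/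
theorem exists_const_of_exp_eq {L M : ℂ → ℂ} {S : Set ℂ} (hS : IsPreconnected S)
    (hL : ContinuousOn L S) (hM : ContinuousOn M S)
    (hLM : ∀ z ∈ S, Complex.exp (L z) = Complex.exp (M z)) :
    ∃ c : ℂ, Complex.exp c = 1 ∧ ∀ z ∈ S, L z = M z + c := by
  have hpi : (2 * Real.pi * Complex.I : ℂ) ≠ 0 := Complex.two_pi_I_ne_zero
  choose! n hn using fun z hz => Complex.exp_eq_exp_iff_exists_int.1 (hLM z hz)
  have hcont : ContinuousOn n S := by
    have h1 : ContinuousOn (fun z => ((L z - M z) / (2 * Real.pi * Complex.I)).re) S := by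
      have := (hL.sub hM).div_const (2 * Real.pi * Complex.I)
      exact Complex.continuous_re.comp_continuousOn this
    have h2 : ContinuousOn (fun z => ((n z : ℤ) : ℝ)) S := by
      refine h1.congr fun z hz => ?_
      have : (L z - M z) / (2 * Real.pi * Complex.I) = n z := by
        rw [div_eq_iff hpi, hn z hz]; ring
      simp only [this]; simp
    exact Int.isClosedEmbedding_coe_real.isEmbedding.continuousOn_iff.2 h2
  rcases S.eq_empty_or_nonempty with rfl | ⟨z₀, hz₀⟩
  · exact ⟨0, by simp, by simp⟩
  · refine ⟨n z₀ * (2 * Real.pi * Complex.I), Complex.exp_int_mul_two_pi_mul_I _, fun z hz => ?_⟩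
    rw [hn z hz, hS.constant hcont hz hz₀]

theorem HasLogOn.union {g : ℂ → ℂ} {X Y : Set ℂ} (hX : HasLogOn g X) (hY : HasLogOn g Y)
    (hXY : IsPreconnected (X ∩ Y))
    (h : (IsClosed X ∧ IsClosed Y) ∨ (IsOpen X ∧ IsOpen Y)) : HasLogOn g (X ∪ Y) := by
  classical
  obtain ⟨L, hL, hLg⟩ := hX
  obtain ⟨M, hM, hMg⟩ := hY
  obtain ⟨c, hc, hcLM⟩ := exists_const_of_exp_eq hXY (hL.mono inter_subset_left)
    (hM.mono inter_subset_right) fun z hz => (hLg z hz.1).trans (hMg z hz.2).symm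
  let N : ℂ → ℂ := fun z => if z ∈ X then L z else M z + c
  have hNX : EqOn N L X := fun z hz => by simp [N, hz]
  have hNY : EqOn N (fun z => M z + c) Y := fun z hz => by
    by_cases hzX : z ∈ X
    · simp [N, hzX, hcLM z ⟨hzX, hz⟩]
    · simp [N, hzX]
  have h1 : ContinuousOn N X := hL.congr hNX
  have h2 : ContinuousOn N Y := (hM.add continuousOn_const).congr hNY
  refine ⟨N, ?_, ?_⟩
  · rcases h with ⟨hX, hY⟩ | ⟨hX, hY⟩
    · exact h1.union_of_isClosed h2 hX hY
    · exact h1.union_of_isOpen h2 hX hY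
  · rintro z (hz | hz)
    · rw [hNX hz, hLg z hz]
    · rw [hNY hz, Complex.exp_add, hc, hMg z hz, mul_one]

/-- Moving the point `γ 0` to `γ 1` off `X` does not change the homotopy class of `z - γ 0`. -/
theorem hasLogOn_of_path {X : Set ℂ} {γ : unitInterval → ℂ} (hγ : Continuous γ)
    (hγX : ∀ t, γ t ∉ X) : HasLogOn (fun z => (z - γ 1) / (z - γ 0)) X := by
  classical
  have hne : ∀ (t : unitInterval) (z : X), (z : ℂ) - γ t ≠ 0 := fun t z h =>
    hγX t (by rw [← sub_eq_zero.1 h]; exact z.2)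
  let H : C(unitInterval × X, {z : ℂ // z ≠ 0}) :=
    ⟨fun p => ⟨((p.2 : ℂ) - γ p.1) / ((p.2 : ℂ) - γ 0), div_ne_zero (hne _ _) (hne _ _)⟩, by
      refine Continuous.subtype_mk (Continuous.div (by fun_prop) (by fun_prop) ?_) _
      exact fun p => hne _ _⟩
  have H0 : ∀ a : X, H (0, a) = (⟨_, Complex.exp_ne_zero ((ContinuousMap.const X (0 : ℂ)) a)⟩ :
      {z : ℂ // z ≠ 0}) := fun a => by
    apply Subtype.ext
    simp [H, div_self (hne 0 a)]
  let F := Complex.isCoveringMap_exp.liftHomotopy H (ContinuousMap.const X 0) H0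
  have hF : ∀ p, Complex.exp (F p) = (H p : ℂ) := fun p =>
    congrArg Subtype.val (congrFun
      (Complex.isCoveringMap_exp.liftHomotopy_lifts H (ContinuousMap.const X 0) H0) p)
  refine ⟨fun z => if hz : z ∈ X then F (1, ⟨z, hz⟩) else 0, ?_, fun z hz => ?_⟩
  · rw [continuousOn_iff_continuous_domRestrict]
    have : Continuous fun z : X => F (1, z) := by fun_prop
    convert this using 1
    ext z
    simp
  · simp only [hz, dite_true, hF]
    rfl

/-- If `a` and `b` lie in a connected set missing the closed set `X`, then `(z - a) / (z - b)` has
a continuous logarithm on `X`. -/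
theorem hasLogOn_of_isPreconnected {X S : Set ℂ} (hX : IsClosed X) (hS : IsPreconnected S)
    (hSX : Disjoint S X) {a b : ℂ} (ha : a ∈ S) (hb : b ∈ S) :
    HasLogOn (fun z => (z - a) / (z - b)) X := by
  have hSX' : S ⊆ Xᶜ := hSX.subset_compl_right
  have ho : IsOpen (connectedComponentIn Xᶜ b) := hX.isOpen_compl.connectedComponentIn
  have hc : IsConnected (connectedComponentIn Xᶜ b) :=
    isConnected_connectedComponentIn_iff.2 (hSX' hb)
  have hp := (ho.isConnected_iff_isPathConnected).1 hc
  obtain ⟨γ, hγ⟩ := hp.joinedIn b (mem_connectedComponentIn (hSX' hb)) a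
    (hS.subset_connectedComponentIn hb hSX' ha)
  have := hasLogOn_of_path γ.continuous (X := X) fun t =>
    connectedComponentIn_subset _ _ (hγ t)
  simpa using this

theorem exists_log_of_continuous {g : ℂ → ℂ} (hg : Continuous g) (h0 : ∀ z, g z ≠ 0) :
    HasLogOn g univ := by
  obtain ⟨f, hf, hfg⟩ := Complex.exists_continuousOn_eqOn_exp_comp (U := (univ : Set ℂ))
    (g := g) (by
      show SimplyConnectedSpace _; exact
      (Homeomorph.Set.univ ℂ).toHomotopyEquiv.simplyConnectedSpace) isOpen_univ hg.continuousOn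
      (by rintro ⟨z, -, hz⟩; exact h0 z hz)
  exact ⟨f, hf, hfg⟩

theorem exists_log_of_continuous_real {g : ℝ → ℂ} (hg : Continuous g) (h0 : ∀ t, g t ≠ 0) :
    ∃ f : ℝ → ℂ, Continuous f ∧ ∀ t, Complex.exp (f t) = g t := by
  obtain ⟨f, hf, hfg⟩ := Complex.exists_continuousOn_eqOn_exp_comp (U := (univ : Set ℝ))
    (g := g) (by
      show SimplyConnectedSpace _; exact
      (Homeomorph.Set.univ ℝ).toHomotopyEquiv.simplyConnectedSpace) isOpen_univ hg.continuousOn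
      (by rintro ⟨z, -, hz⟩; exact h0 z hz)
  exact ⟨f, continuousOn_univ.1 hf, fun t => hfg (mem_univ t)⟩

/-- The identity has no continuous logarithm on a circle around the origin. -/
theorem not_hasLogOn_sphere (a : ℂ) {r : ℝ} (hr : 0 < r) :
    ¬ HasLogOn (fun z => z - a) (sphere a r) := by
  rintro ⟨L, hL, hLg⟩
  have hmem : ∀ θ : ℝ, circleMap a r θ ∈ sphere a r := fun θ => circleMap_mem_sphere a hr.le θ
  have hc : Continuous fun θ : ℝ => L (circleMap a r θ) :=
    hL.comp_continuous (continuous_circleMap a r) hmem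
  have hr0 : (r : ℂ) ≠ 0 := by exact_mod_cast hr.ne'
  have key : ∀ θ : ℝ, ∃ n : ℤ, L (circleMap a r θ) - Complex.log r - θ * Complex.I =
      n * (2 * Real.pi * Complex.I) := fun θ => by
    have h1 : Complex.exp (L (circleMap a r θ)) = Complex.exp (Complex.log r + θ * Complex.I) := by
      rw [hLg _ (hmem θ), Complex.exp_add, Complex.exp_log hr0]
      simp [circleMap]
    obtain ⟨n, hn⟩ := Complex.exp_eq_exp_iff_exists_int.1 h1
    exact ⟨n, by rw [hn]; ring⟩
  choose n hn using key
  have hpi : (2 * Real.pi * Complex.I : ℂ) ≠ 0 := Complex.two_pi_I_ne_zero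
  have hcont : Continuous n := by
    have h2 : Continuous fun θ : ℝ => ((n θ : ℤ) : ℝ) := by
      have : (fun θ : ℝ => ((n θ : ℤ) : ℝ)) = fun θ : ℝ =>
          ((L (circleMap a r θ) - Complex.log r - θ * Complex.I) /
            (2 * Real.pi * Complex.I)).re := by
        ext θ
        rw [hn θ, mul_div_cancel_right₀ _ hpi]
        simp
      rw [this]
      exact Complex.continuous_re.comp (((hc.sub continuous_const).sub (by fun_prop)).div_const _)
    exact Int.isClosedEmbedding_coe_real.isEmbedding.continuous_iff.2 h2
  have heq : n (2 * Real.pi) = n 0 :=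
    isPreconnected_univ.constant hcont.continuousOn (mem_univ _) (mem_univ _)
  have e1 := hn (2 * Real.pi)
  have e0 := hn 0
  rw [heq] at e1
  have hper : circleMap a r (2 * Real.pi) = circleMap a r 0 := by simp [circleMap]
  rw [hper] at e1
  have : ((2 * Real.pi : ℝ) : ℂ) * Complex.I = 0 := by
    have h3 := e0.trans e1.symm
    have h4 : ((0 : ℝ) : ℂ) = 0 := Complex.ofReal_zero
    rw [h4] at h3
    linear_combination h3
  apply hpi
  push_cast at this
  linear_combination this

/-- A nonvanishing continuous function on an arc has a continuous logarithm. -/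
theorem hasLogOn_arc {γ : ℝ → ℂ} {s t : ℝ} (hγ : Continuous γ) (hst : s ≤ t)
    (hinj : InjOn γ (Icc s t)) {g : ℂ → ℂ} (hg : ContinuousOn g (γ '' Icc s t))
    (h0 : ∀ z ∈ γ '' Icc s t, g z ≠ 0) : HasLogOn g (γ '' Icc s t) := by
  have hpm : ∀ u : ℝ, γ (projIcc s t hst u) ∈ γ '' Icc s t := fun u =>
    mem_image_of_mem _ (projIcc s t hst u).2
  obtain ⟨f, hf, hfg⟩ := exists_log_of_continuous_real (g := fun u => g (γ (projIcc s t hst u)))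
    (hg.comp_continuous (hγ.comp (continuous_subtype_val.comp continuous_projIcc)) hpm)
    fun u => h0 _ (hpm u)
  have hleft : ∀ u ∈ Icc s t, Function.invFunOn γ (Icc s t) (γ u) = u := fun u hu =>
    hinj.leftInvOn_invFunOn hu
  refine ⟨fun z => f (Function.invFunOn γ (Icc s t) z), ?_, ?_⟩
  · refine hf.comp_continuousOn ?_
    rw [continuousOn_iff_isClosed]
    intro T hT
    refine ⟨γ '' (T ∩ Icc s t), ((isCompact_Icc.inter_left hT).image hγ).isClosed, ?_⟩
    ext z
    constructor
    · rintro ⟨hz, u, hu, rfl⟩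
      rw [mem_preimage, hleft u hu] at hz
      exact ⟨⟨u, ⟨hz, hu⟩, rfl⟩, ⟨u, hu, rfl⟩⟩
    · rintro ⟨⟨u, ⟨hT, hu⟩, rfl⟩, h⟩
      exact ⟨by rwa [mem_preimage, hleft u hu], h⟩
  · rintro _ ⟨u, hu, rfl⟩
    simp only [hleft u hu, hfg, projIcc_of_mem hst hu]

/-- The exterior of a disk is connected. -/
theorem isPreconnected_compl_closedBall {R : ℝ} (hR : 0 < R) :
    IsPreconnected (closedBall (0 : ℂ) R)ᶜ := by
  have h1 : IsPreconnected {z : ℂ | Real.log R < z.re} :=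
    (convex_halfSpace_re_gt (Real.log R)).isPreconnected
  have h2 : (closedBall (0 : ℂ) R)ᶜ = Complex.exp '' {z : ℂ | Real.log R < z.re} := by
    ext z
    simp only [mem_compl_iff, mem_closedBall, dist_zero_right, not_le, mem_image, mem_ofPred_eq]
    constructor
    · intro hz
      have hz0 : z ≠ 0 := by rintro rfl; simp at hz; linarith
      exact ⟨Complex.log z, by rw [Complex.log_re]; exact Real.log_lt_log hR hz,
        Complex.exp_log hz0⟩
    · rintro ⟨w, hw, rfl⟩
      rw [Complex.norm_exp]
      exact (Real.log_lt_iff_lt_exp hR).1 hw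
  rw [h2]
  exact h1.image _ Complex.continuous_exp.continuousOn

theorem frontier_connectedComponentIn_subset {O : Set ℂ} (hO : IsOpen O) (x : ℂ) :
    frontier (connectedComponentIn O x) ⊆ Oᶜ := by
  intro z hz hzO
  have ho : IsOpen (connectedComponentIn O z) := hO.connectedComponentIn
  obtain ⟨y, hyz, hyx⟩ := mem_closure_iff.1 (frontier_subset_closure hz) _ ho
    (mem_connectedComponentIn hzO)
  rw [connectedComponentIn_eq hyx, ← connectedComponentIn_eq hyz, ho.frontier_eq] at hz
  exact hz.2 (mem_connectedComponentIn hzO)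

theorem mem_connectedComponentIn_of_not_isBounded {X : Set ℂ} (hX : IsCompact X) {a b : ℂ}
    (ha : ¬ Bornology.IsBounded (connectedComponentIn Xᶜ a))
    (hb : ¬ Bornology.IsBounded (connectedComponentIn Xᶜ b)) (hbX : b ∉ X) :
    b ∈ connectedComponentIn Xᶜ a := by
  obtain ⟨R, hR, hXR⟩ := hX.isBounded.subset_closedBall_lt 0 0
  have key : ∀ c, ¬ Bornology.IsBounded (connectedComponentIn Xᶜ c) →
      (closedBall (0 : ℂ) R)ᶜ ⊆ connectedComponentIn Xᶜ c := by
    intro c hc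
    obtain ⟨c', hc', hcR⟩ := not_subset.1 fun h => hc (isBounded_closedBall.subset h)
    rw [connectedComponentIn_eq hc']
    exact (isPreconnected_compl_closedBall hR).subset_connectedComponentIn hcR
      (compl_subset_compl.2 hXR)
  obtain ⟨c', hc', hcR⟩ := not_subset.1 fun h => hb (isBounded_closedBall.subset h)
  rw [connectedComponentIn_eq (key a ha hcR), ← connectedComponentIn_eq hc']
  exact mem_connectedComponentIn hbX

theorem not_hasLogOn_of_isBounded {X : Set ℂ} (hX : IsCompact X) {a b : ℂ} (ha : a ∉ X)
    (hbX : b ∉ X) (hb : b ∉ connectedComponentIn Xᶜ a)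
    (hbd : Bornology.IsBounded (connectedComponentIn Xᶜ a)) :
    ¬ HasLogOn (fun z => (z - a) / (z - b)) X := by
  classical
  rintro ⟨L, hL, hLg⟩
  obtain ⟨M, hM⟩ := ContinuousMap.exists_restrict_eq hX.isClosed
    ⟨X.domRestrict L, continuousOn_iff_continuous_domRestrict.1 hL⟩
  have hML : ∀ z ∈ X, M z = L z := fun z hz => congrArg (fun f => f ⟨z, hz⟩) hM
  set V := connectedComponentIn Xᶜ a with hV
  have hfr : frontier V ⊆ X := by
    simpa using frontier_connectedComponentIn_subset hX.isClosed.isOpen_compl a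
  let h : ℂ → ℂ := fun z => if z ∈ V then (z - b) * Complex.exp (M z) else z - a
  have hcont : Continuous h := by
    refine Continuous.if (fun z hz => ?_) (by fun_prop) (by fun_prop)
    have hzX : z ∈ X := hfr hz
    have : z - b ≠ 0 := fun h0 => hbX (sub_eq_zero.1 h0 ▸ hzX)
    rw [hML z hzX, hLg z hzX, mul_div_cancel₀ _ this]
  have hne : ∀ z, h z ≠ 0 := by
    intro z
    by_cases hz : z ∈ V
    · simp only [h, hz, if_true]
      exact mul_ne_zero (fun h0 => hb (sub_eq_zero.1 h0 ▸ hz)) (Complex.exp_ne_zero _)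
    · simp only [h, hz, if_false]
      exact fun h0 => hz (sub_eq_zero.1 h0 ▸ mem_connectedComponentIn ha)
  obtain ⟨R, hR, hVR⟩ := hbd.subset_ball_lt 0 a
  refine not_hasLogOn_sphere a hR
    (((exists_log_of_continuous hcont hne).mono (subset_univ _)).congr fun z hz => ?_)
  have : z ∉ V := fun hzV => by
    have := hVR hzV
    rw [mem_ball, mem_sphere.1 hz] at this
    exact lt_irrefl _ this
  simp [h, this]

/-- **Borsuk's separation criterion**: if `(z - a) / (z - b)` has a continuous logarithm on the
compact set `X`, then `X` does not separate `a` from `b`. -/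
theorem mem_connectedComponentIn_of_hasLogOn {X : Set ℂ} (hX : IsCompact X) {a b : ℂ}
    (ha : a ∉ X) (hb : b ∉ X) (h : HasLogOn (fun z => (z - a) / (z - b)) X) :
    b ∈ connectedComponentIn Xᶜ a := by
  by_contra hab
  by_cases hba : Bornology.IsBounded (connectedComponentIn Xᶜ a)
  · exact not_hasLogOn_of_isBounded hX ha hb hab hba h
  by_cases hbb : Bornology.IsBounded (connectedComponentIn Xᶜ b)
  · refine not_hasLogOn_of_isBounded hX hb ha (fun hab' => hab ?_) hbb
      (h.inv.congr fun z _ => by simp)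
    rw [← connectedComponentIn_eq hab']
    exact mem_connectedComponentIn hb
  · exact hab (mem_connectedComponentIn_of_not_isBounded hX hba hbb hb)

/-- In a compact planar set, components have arbitrarily small relatively clopen neighbourhoods. -/
theorem exists_clopen_of_connectedComponentIn_subset {X N : Set ℂ} (hX : IsCompact X) {x : ℂ}
    (hx : x ∈ X) (hN : IsOpen N) (hxN : connectedComponentIn X x ⊆ N) :
    ∃ K ⊆ X, IsClosed K ∧ IsClosed (X \ K) ∧ x ∈ K ∧ K ⊆ N := by
  have := isCompact_iff_compactSpace.1 hX
  let x' : X := ⟨x, hx⟩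
  have hdir : Directed (· ⊇ ·) fun s : { s : Set X // IsClopen s ∧ x' ∈ s } => (s : Set X) :=
    fun s t => ⟨⟨s ∩ t, s.2.1.inter t.2.1, s.2.2, t.2.2⟩, inter_subset_left, inter_subset_right⟩
  have : Nonempty { s : Set X // IsClopen s ∧ x' ∈ s } := ⟨⟨univ, isClopen_univ, mem_univ _⟩⟩
  obtain ⟨s, hs⟩ := exists_subset_nhds_of_isCompact (U := ((↑) : X → ℂ) ⁻¹' N) hdir
    (fun s => s.2.1.1.isCompact) (by
      intro y hy
      rw [← connectedComponent_eq_iInter_isClopen] at hy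
      refine (hN.preimage continuous_subtype_val).mem_nhds (hxN ?_)
      rw [connectedComponentIn_eq_image hx]
      exact mem_image_of_mem _ hy)
  refine ⟨(↑) '' (s : Set X), Subtype.coe_image_subset _ _,
    (s.2.1.1.isCompact.image continuous_subtype_val).isClosed, ?_, ⟨x', s.2.2, rfl⟩, ?_⟩
  · have : X \ ((↑) '' (s : Set X)) = (↑) '' (s : Set X)ᶜ := by
      ext z; simp
    rw [this]
    exact (s.2.1.2.isClosed_compl.isCompact.image continuous_subtype_val).isClosed
  · rintro _ ⟨y, hy, rfl⟩
    exact hs hy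

/-- A nonvanishing continuous function on a compact set has a continuous logarithm as soon as it
has one on every component. -/
theorem hasLogOn_of_connectedComponentIn {X : Set ℂ} (hX : IsCompact X) {g : ℂ → ℂ}
    (hg : ContinuousOn g X) (h0 : ∀ z ∈ X, g z ≠ 0)
    (h : ∀ x ∈ X, HasLogOn g (connectedComponentIn X x)) : HasLogOn g X := by
  have key : ∃ K ⊆ X, IsClosed K ∧ IsClosed (X \ K) ∧ X ∩ X ⊆ K ∧ HasLogOn g K := by
    refine hX.induction_on (p := fun s => ∃ K ⊆ X, IsClosed K ∧ IsClosed (X \ K) ∧ s ∩ X ⊆ K ∧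
      HasLogOn g K) ⟨∅, by simp, by simp, by simpa using hX.isClosed, by simp, fun _ => 0, by simp,
        by simp⟩ ?_ ?_ ?_
    · rintro s t hst ⟨K, h1, h2, h3, h4, h5⟩
      exact ⟨K, h1, h2, h3, (inter_subset_inter_left _ hst).trans h4, h5⟩
    · rintro s t ⟨K, h1, h2, h3, h4, h5⟩ ⟨K', h1', h2', h3', h4', h5'⟩
      refine ⟨K ∪ K', union_subset h1 h1', h2.union h2', ?_, ?_, ?_⟩
      · rw [← Set.sdiff_inter_sdiff]; exact h3.inter h3'
      · rw [union_inter_distrib_right]; exact union_subset_union h4 h4'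
      · have e : K ∪ K' = K ∪ (K' ∩ (X \ K)) := by
          ext z
          have := @h1' z
          simp only [mem_union, mem_inter_iff, Set.mem_sdiff]
          tauto
        have e' : K ∩ (K' ∩ (X \ K)) = ∅ := by
          ext z; simp; tauto
        rw [e]
        refine h5.union (h5'.mono inter_subset_left) ?_ (Or.inl ⟨h2, h2'.inter h3⟩)
        rw [e']; exact isPreconnected_empty
    · intro x hx
      obtain ⟨L, hL, hLg⟩ := h x hx
      have hcl : IsClosed (connectedComponentIn X x) := by
        rw [connectedComponentIn_eq_image hx]
        have := isCompact_iff_compactSpace.1 hX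
        exact (isClosed_connectedComponent.isCompact.image continuous_subtype_val).isClosed
      obtain ⟨M, hM⟩ := ContinuousMap.exists_restrict_eq hcl
        ⟨Set.domRestrict _ L, continuousOn_iff_continuous_domRestrict.1 hL⟩
      have hML : ∀ z ∈ connectedComponentIn X x, M z = L z := fun z hz =>
        congrArg (fun f => f ⟨z, hz⟩) hM
      have hq : ContinuousOn (fun z => g z / Complex.exp (M z)) X :=
        hg.div (by fun_prop) fun z _ => Complex.exp_ne_zero _
      have hF : IsClosed (X ∩ (fun z => ‖g z / Complex.exp (M z) - 1‖) ⁻¹' Ici 1) :=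
        (hq.sub continuousOn_const).norm.preimage_isClosed_of_isClosed hX.isClosed isClosed_Ici
      obtain ⟨K, hKX, hK, hK', hxK, hKN⟩ := exists_clopen_of_connectedComponentIn_subset hX hx
        hF.isOpen_compl (by
          rintro z hz ⟨hzX, hz1⟩
          rw [mem_preimage, hML z hz, hLg z hz, div_self (h0 z hzX)] at hz1
          simp at hz1; linarith)
      have hK1 : ∀ z ∈ K, ‖g z / Complex.exp (M z) - 1‖ < 1 := fun z hz => by
        by_contra! hlt
        exact hKN hz ⟨hKX hz, hlt⟩
      refine ⟨K, ?_, K, hKX, hK, hK', inter_subset_left, ?_⟩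
      · refine mem_nhdsWithin.2 ⟨(X \ K)ᶜ, hK'.isOpen_compl, fun hn => hn.2 hxK, ?_⟩
        rintro z ⟨hz1, hz2⟩
        by_contra hzK
        exact hz1 ⟨hz2, hzK⟩
      · refine ⟨fun z => Complex.log (g z / Complex.exp (M z)) + M z, ?_, fun z hz => ?_⟩
        · refine ContinuousOn.add (ContinuousOn.clog (hq.mono hKX) fun z hz => ?_) (by fun_prop)
          have := Complex.mem_slitPlane_of_norm_lt_one (hK1 z hz)
          simpa using this
        · rw [Complex.exp_add,
            Complex.exp_log (div_ne_zero (h0 z (hKX hz)) (Complex.exp_ne_zero _)),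
            div_mul_cancel₀ _ (Complex.exp_ne_zero _)]
  obtain ⟨K, -, -, -, hXK, hK⟩ := key
  exact hK.mono (by simpa using hXK)

/-- The map `γ` traverses the Jordan curve `J` once over `[0, 1]`. -/
structure IsLoopParam (γ : ℝ → ℂ) (J : Set ℂ) : Prop where
  continuous : Continuous γ
  eq_endpoints : γ 0 = γ 1
  injOn : InjOn γ (Ico 0 1)
  image_eq : γ '' Icc 0 1 = J

namespace IsLoopParam

variable {γ : ℝ → ℂ} {J : Set ℂ}

theorem eq_zero_and_eq_one (h : IsLoopParam γ J) {s t : ℝ} (hs : 0 ≤ s) (hst : s < t) (ht : t ≤ 1)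
    (hγ : γ s = γ t) : s = 0 ∧ t = 1 := by
  rcases ht.lt_or_eq with ht1 | rfl
  · exact absurd (h.injOn ⟨hs, hst.trans ht1⟩ ⟨hs.trans hst.le, ht1⟩ hγ) hst.ne
  · rw [← h.eq_endpoints] at hγ
    exact ⟨h.injOn ⟨hs, hst⟩ ⟨le_rfl, zero_lt_one⟩ hγ, rfl⟩

theorem injOn_Icc (h : IsLoopParam γ J) {s t : ℝ} (hs : 0 ≤ s) (ht : t ≤ 1)
    (hst : 0 < s ∨ t < 1) : InjOn γ (Icc s t) := by
  have key : ∀ x ∈ Icc s t, ∀ y ∈ Icc s t, x < y → γ x ≠ γ y := by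
    intro x hx y hy hxy hγ
    obtain ⟨rfl, rfl⟩ := h.eq_zero_and_eq_one (hs.trans hx.1) hxy (hy.2.trans ht) hγ
    rcases hst with hst | hst
    · exact hst.not_ge hx.1
    · exact hst.not_ge hy.2
  intro x hx y hy hγ
  by_contra hne
  rcases lt_or_gt_of_ne hne with hlt | hlt
  · exact key x hx y hy hlt hγ
  · exact key y hy x hx hlt hγ.symm

theorem mem (h : IsLoopParam γ J) {t : ℝ} (ht : t ∈ Icc (0 : ℝ) 1) : γ t ∈ J :=
  h.image_eq ▸ mem_image_of_mem _ ht

theorem exists_eq (h : IsLoopParam γ J) {z : ℂ} (hz : z ∈ J) : ∃ t ∈ Icc (0 : ℝ) 1, γ t = z := by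
  rwa [← h.image_eq] at hz

theorem image_subset (h : IsLoopParam γ J) {s t : ℝ} (hs : 0 ≤ s) (ht : t ≤ 1) :
    γ '' Icc s t ⊆ J :=
  h.image_eq ▸ image_mono (Icc_subset_Icc hs ht)

theorem isCompact (h : IsLoopParam γ J) : IsCompact J :=
  h.image_eq ▸ isCompact_Icc.image h.continuous

theorem isCompact_image (h : IsLoopParam γ J) (s t : ℝ) : IsCompact (γ '' Icc s t) :=
  isCompact_Icc.image h.continuous

theorem isPreconnected_image (h : IsLoopParam γ J) {S : Set ℝ} (hS : S.OrdConnected) :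
    IsPreconnected (γ '' S) :=
  hS.isPreconnected.image _ h.continuous.continuousOn

theorem image_Icc_union (h : IsLoopParam γ J) {τ : ℝ} (hτ : τ ∈ Icc (0 : ℝ) 1) :
    γ '' Icc 0 τ ∪ γ '' Icc τ 1 = J := by
  rw [← image_union, Icc_union_Icc_eq_Icc hτ.1 hτ.2, h.image_eq]

theorem image_Icc_inter (h : IsLoopParam γ J) {τ : ℝ} (hτ : τ ∈ Icc (0 : ℝ) 1) :
    γ '' Icc 0 τ ∩ γ '' Icc τ 1 = {γ 0, γ τ} := by
  ext z
  constructor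
  · rintro ⟨⟨s, hs, rfl⟩, t, ht, hst⟩
    rcases (hs.2.trans ht.1).lt_or_eq with hlt | rfl
    · obtain ⟨rfl, rfl⟩ := h.eq_zero_and_eq_one hs.1 hlt ht.2 hst.symm
      exact Or.inl rfl
    · exact Or.inr (by rw [le_antisymm hs.2 ht.1]; rfl)
  · rintro (rfl | rfl)
    · exact ⟨⟨0, ⟨le_rfl, hτ.1⟩, rfl⟩, ⟨1, ⟨hτ.2, le_rfl⟩, h.eq_endpoints.symm⟩⟩
    · exact ⟨⟨τ, ⟨hτ.1, le_rfl⟩, rfl⟩, ⟨τ, ⟨le_rfl, hτ.2⟩, rfl⟩⟩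

end IsLoopParam

theorem exp_two_pi_mul_I_mul_eq_iff {s t : ℝ} :
    Complex.exp (2 * Real.pi * Complex.I * s) = Complex.exp (2 * Real.pi * Complex.I * t) ↔
      ∃ n : ℤ, s = t + n := by
  rw [Complex.exp_eq_exp_iff_exists_int]
  refine exists_congr fun n => ?_
  have : (2 * Real.pi * Complex.I * t + n * (2 * Real.pi * Complex.I) : ℂ) =
    2 * Real.pi * Complex.I * ((t + n : ℝ) : ℂ) := by push_cast; ring
  rw [this, mul_right_inj' Complex.two_pi_I_ne_zero]
  exact Complex.ofReal_inj

theorem norm_exp_two_pi_mul_I_mul (t : ℝ) : ‖Complex.exp (2 * Real.pi * Complex.I * t)‖ = 1 := by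
  rw [Complex.norm_exp]; simp

theorem exists_exp_two_pi_mul_I_mul_eq {z : ℂ} (hz : ‖z‖ = 1) :
    ∃ t ∈ Ico (0 : ℝ) 1, Complex.exp (2 * Real.pi * Complex.I * t) = z := by
  refine ⟨Int.fract (Complex.arg z / (2 * Real.pi)), ⟨Int.fract_nonneg _, Int.fract_lt_one _⟩, ?_⟩
  have h1 : Complex.exp (2 * Real.pi * Complex.I * (Complex.arg z / (2 * Real.pi) : ℝ)) = z := by
    have : (2 * Real.pi * Complex.I * (Complex.arg z / (2 * Real.pi) : ℝ) : ℂ) =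
        Complex.arg z * Complex.I := by
      have := Real.pi_ne_zero
      push_cast; field_simp
    rw [this]
    simpa [hz] using Complex.norm_mul_exp_arg_mul_I z
  refine Eq.trans (exp_two_pi_mul_I_mul_eq_iff.2 ⟨-⌊Complex.arg z / (2 * Real.pi)⌋, ?_⟩) h1
  rw [Int.fract]; push_cast; ring

theorem IsJordanCurve.exists_isLoopParam {J : Set ℂ} (hJ : IsJordanCurve J) {a : ℂ} (ha : a ∈ J) :
    ∃ γ : ℝ → ℂ, IsLoopParam γ J ∧ γ 0 = a := by
  obtain ⟨h⟩ := hJ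
  have hn : ∀ x : sphere (0 : ℂ) 1, ‖(x : ℂ)‖ = 1 := fun x => mem_sphere_zero_iff_norm.1 x.2
  obtain ⟨u, hu⟩ : ∃ u : ℂ, u = h ⟨a, ha⟩ := ⟨_, rfl⟩
  have hu1 : ‖u‖ = 1 := hu ▸ hn _
  have hu0 : u ≠ 0 := by rintro h0; rw [h0] at hu1; simp at hu1
  let e : ℝ → sphere (0 : ℂ) 1 := fun t =>
    ⟨u * Complex.exp (2 * Real.pi * Complex.I * t), by
      rw [mem_sphere_zero_iff_norm, norm_mul, hu1, norm_exp_two_pi_mul_I_mul, one_mul]⟩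
  have he : Continuous e := by
    refine Continuous.subtype_mk ?_ _
    fun_prop
  have hee : ∀ s t, e s = e t ↔ ∃ n : ℤ, s = t + n := fun s t => by
    rw [← exp_two_pi_mul_I_mul_eq_iff, Subtype.ext_iff]
    exact mul_right_inj' hu0
  have he' : ∀ s t, ((h.symm (e s) : J) : ℂ) = h.symm (e t) ↔ ∃ n : ℤ, s = t + n := fun s t => by
    rw [← hee, ← Subtype.ext_iff, h.symm.injective.eq_iff]
  refine ⟨fun t => h.symm (e t), ⟨by fun_prop, (he' _ _).2 ⟨-1, by simp⟩, ?_, ?_⟩, ?_⟩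
  · intro s hs t ht hst
    obtain ⟨n, hn⟩ := (he' _ _).1 hst
    have h1 : (n : ℝ) < 1 := by linarith [hs.2, ht.1]
    have h2 : (-1 : ℝ) < n := by linarith [hs.1, ht.2]
    have : n = 0 := by
      have h1 : n < 1 := by exact_mod_cast h1
      have h2 : -1 < n := by exact_mod_cast h2
      omega
    simpa [this] using hn
  · apply Subset.antisymm
    · rintro _ ⟨t, -, rfl⟩
      exact (h.symm (e t)).2
    · intro z hz
      obtain ⟨t, ht, htz⟩ := exists_exp_two_pi_mul_I_mul_eq (z := h ⟨z, hz⟩ / u)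
        (by rw [norm_div, hn, hu1, div_one])
      refine ⟨t, Ico_subset_Icc_self ht, ?_⟩
      have : e t = h ⟨z, hz⟩ := Subtype.ext (by
        show u * _ = _
        rw [htz, mul_div_cancel₀ _ hu0])
      simp [this]
  · have : e 0 = h ⟨a, ha⟩ := Subtype.ext (by
      show u * _ = _
      simp [hu])
    simp [this]

theorem subset_of_isPreconnected_of_disjoint_frontier {V A : Set ℂ} (hV : IsPreconnected V)
    (hA : Disjoint V (frontier A)) (hne : (V ∩ A).Nonempty) : V ⊆ A := by
  have hmem_interior : ∀ z ∈ V, z ∈ closure A → z ∈ interior A := fun z hz hzA => by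
    by_contra h
    exact disjoint_left.1 hA hz ⟨hzA, h⟩
  refine (hV.subset_left_of_subset_union isOpen_interior isClosed_closure.isOpen_compl
    (disjoint_left.2 fun z hz hz' => hz' (subset_closure (interior_subset hz))) (fun z hz => ?_)
    ?_).trans interior_subset
  · by_cases h : z ∈ closure A
    · exact Or.inl (hmem_interior z hz h)
    · exact Or.inr h
  · obtain ⟨z, hz, hzA⟩ := hne
    exact ⟨z, hz, hmem_interior z hz (subset_closure hzA)⟩

theorem isClosed_connectedComponentIn {X : Set ℂ} (hX : IsClosed X) (x : ℂ) :
    IsClosed (connectedComponentIn X x) := by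
  by_cases hx : x ∈ X
  · rw [connectedComponentIn_eq_image hx]
    exact hX.isClosedEmbedding_subtypeVal.isClosedMap _ isClosed_connectedComponent
  · rw [connectedComponentIn_eq_empty hx]; exact isClosed_empty

/-- Away from its base point, a Jordan curve is contained in a proper arc. -/
theorem IsLoopParam.exists_sdiff_ball_subset {γ : ℝ → ℂ} {J : Set ℂ} (hγ : IsLoopParam γ J) {r : ℝ}
    (hr : 0 < r) : ∃ σ > 0, σ ≤ 1 / 2 ∧ J \ ball (γ 0) r ⊆ γ '' Icc σ (1 - σ) := by
  obtain ⟨s, hs, hs1⟩ : ∃ s > 0, ∀ t, |t| < s → dist (γ t) (γ 0) < r := by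
    simpa [Real.dist_eq] using Metric.continuous_iff.1 hγ.continuous 0 r hr
  obtain ⟨s', hs', hs1'⟩ : ∃ s > 0, ∀ t, |t - 1| < s → dist (γ t) (γ 1) < r := by
    simpa [Real.dist_eq] using Metric.continuous_iff.1 hγ.continuous 1 r hr
  set σ := min (min s s') (1 / 2) with hσ
  have hσs : σ ≤ s := (min_le_left _ _).trans (min_le_left _ _)
  have hσs' : σ ≤ s' := (min_le_left _ _).trans (min_le_right _ _)
  refine ⟨σ, by positivity, min_le_right _ _, ?_⟩
  rintro z ⟨hz, hzb⟩
  obtain ⟨t, ht, rfl⟩ := hγ.exists_eq hz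
  by_contra htσ
  refine hzb ?_
  have : t < σ ∨ 1 - σ < t := by
    by_contra! h
    exact htσ (mem_image_of_mem _ ⟨h.1, h.2⟩)
  rcases this with h | h
  · exact hs1 t (by rw [abs_lt]; constructor <;> linarith [ht.1])
  · rw [mem_ball, hγ.eq_endpoints]
    exact hs1' t (by rw [abs_lt]; constructor <;> linarith [ht.2])

theorem exists_isOpen_isPreconnected_sdiff {P : Set ℂ} {w : ℂ} (hw : w ∈ P)
    (hP : P = {w} ∨ IsJordanCurve P) {r : ℝ} (hr : 0 < r) :
    ∃ U : Set ℂ, IsOpen U ∧ w ∈ U ∧ U ⊆ ball w r ∧ IsPreconnected (P \ U) := by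
  rcases hP with rfl | hP
  · refine ⟨ball w r, isOpen_ball, mem_ball_self hr, Subset.rfl, ?_⟩
    rw [sdiff_eq_empty.2 (by simpa using hr)]
    exact isPreconnected_empty
  obtain ⟨γ, hγ, rfl⟩ := hP.exists_isLoopParam hw
  obtain ⟨σ, hσ0, hσ2, hσ⟩ := hγ.exists_sdiff_ball_subset hr
  refine ⟨ball (γ 0) r \ γ '' Icc σ (1 - σ),
    isOpen_ball.sdiff (hγ.isCompact_image _ _).isClosed, ⟨mem_ball_self hr, ?_⟩, sdiff_subset, ?_⟩
  · rintro ⟨t, ht, hγt⟩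
    linarith [(hγ.eq_zero_and_eq_one le_rfl (hσ0.trans_le ht.1) (by linarith [ht.2]) hγt.symm).2,
      ht.2]
  · have : P \ (ball (γ 0) r \ γ '' Icc σ (1 - σ)) = γ '' Icc σ (1 - σ) := by
      apply Subset.antisymm
      · rintro z ⟨hz, hzU⟩
        by_contra hzσ
        exact hzσ (hσ ⟨hz, fun hzb => hzU ⟨hzb, hzσ⟩⟩)
      · intro z hz
        exact ⟨hγ.image_subset hσ0.le (by linarith) hz, fun h => h.2 hz⟩
    rw [this]
    exact hγ.isPreconnected_image ordConnected_Icc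

/-- If a component of `K ∪ S` meets `S`, then it can only contain components of `K` that
meet `S`. -/
theorem connectedComponentIn_inter_nonempty {K S : Set ℂ} (hK : IsCompact K) (hS : IsClosed S)
    {Y : Set ℂ} (hY : IsPreconnected Y) (hYX : Y ⊆ K ∪ S) (hYS : (Y ∩ S).Nonempty) {z : ℂ}
    (hz : z ∈ Y) (hzK : z ∈ K) : (connectedComponentIn K z ∩ S).Nonempty := by
  by_contra hne
  obtain ⟨T, hTK, hT, hT', hzT, hTS⟩ := exists_clopen_of_connectedComponentIn_subset hK hzK
    hS.isOpen_compl (fun q hq hqS => hne ⟨q, hq, hqS⟩)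
  obtain ⟨q, -, hqT, hq⟩ := isPreconnected_closed_iff.1 hY T ((K \ T) ∪ S) hT (hT'.union hS)
    (fun q hq => by
      have := hYX hq
      simp only [mem_union, Set.mem_sdiff] at this ⊢
      tauto)
    ⟨z, hz, hzT⟩ (hYS.mono (inter_subset_inter_right _ subset_union_right))
  rcases hq with hq | hq
  · exact hq.2 hqT
  · exact hTS hqT hq

/-- A generalized Jordan domain is locally connected at each of its boundary points. -/
theorem IsGeneralizedJordanDomain.exists_mem_connectedComponentIn_inter_ball {Ω : Set ℂ}
    (hΩ : IsGeneralizedJordanDomain Ω) {w : ℂ} (hw : w ∈ frontier Ω) {ε : ℝ} (hε : 0 < ε) :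
    ∃ δ > 0, δ ≤ ε ∧ ∀ a ∈ Ω ∩ ball w δ, ∀ b ∈ Ω ∩ ball w δ,
      b ∈ connectedComponentIn (Ω ∩ ball w ε) a := by
  obtain ⟨⟨-, hΩo, hΩc⟩, -, ⟨hK, -, hfin⟩, hcomp⟩ := hΩ
  set K := frontier Ω with hKdef
  have hdisj : Disjoint Ω K := by
    rw [hKdef, hΩo.frontier_eq]; exact disjoint_sdiff_right
  set P := connectedComponentIn K w with hPdef
  have hwP : w ∈ P := mem_connectedComponentIn hw
  have hPcl : IsClosed P := isClosed_connectedComponentIn hK.isClosed _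
  obtain ⟨U, hU, hwU, hUb, hPU⟩ :=
    exists_isOpen_isPreconnected_sdiff hwP (hcomp w hw) (half_pos hε)
  set 𝓕 := {Q : Set ℂ | (∃ x ∈ K, Q = connectedComponentIn K x) ∧ ε / 4 < Metric.diam Q} with h𝓕
  have hFfin : (𝓕 \ {P}).Finite := (hfin (ε / 4) (by positivity)).subset sdiff_subset
  have hFcl : IsClosed (⋃₀ (𝓕 \ {P})) := by
    rw [sUnion_eq_biUnion]
    refine hFfin.isClosed_biUnion ?_
    rintro Q ⟨⟨⟨x, -, rfl⟩, -⟩, -⟩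
    exact isClosed_connectedComponentIn hK.isClosed _
  have hPF : ∀ z ∈ P, z ∉ ⋃₀ (𝓕 \ {P}) := by
    rintro z hz ⟨Q, ⟨⟨⟨x, -, rfl⟩, -⟩, hQP⟩, hzQ⟩
    exact hQP (by rw [mem_singleton_iff, connectedComponentIn_eq hzQ, hPdef,
      connectedComponentIn_eq hz])
  set U' := U \ ⋃₀ (𝓕 \ {P}) with hU'
  have hU'o : IsOpen U' := hU.sdiff hFcl
  have hPU' : P \ U' = P \ U := by
    ext z
    have := hPF z
    simp only [hU', Set.mem_sdiff]
    tauto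
  obtain ⟨δ, hδ, hδU⟩ := Metric.isOpen_iff.1 hU'o w ⟨hwU, hPF w hwP⟩
  refine ⟨min δ ε, by positivity, min_le_right _ _, ?_⟩
  rintro a ⟨haΩ, ha⟩ b ⟨hbΩ, hb⟩
  set X := K ∪ sphere w ε with hX
  have hXc : IsCompact X := hK.union (isCompact_sphere w ε)
  have hsub : ball w (min δ ε) ⊆ U' := (ball_subset_ball (min_le_left _ _)).trans hδU
  have hnS : ∀ z ∈ ball w (min δ ε), z ∉ sphere w ε := fun z hz hzS => by
    rw [mem_sphere] at hzS
    rw [mem_ball] at hz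
    linarith [min_le_right δ ε]
  have hnX : ∀ z ∈ Ω, z ∈ ball w (min δ ε) → z ∉ X := by
    rintro z hzΩ hz (hzK | hzS)
    · exact disjoint_left.1 hdisj hzΩ hzK
    · exact hnS z hz hzS
  have hbX := hnX b hbΩ hb
  have haX := hnX a haΩ ha
  have hlogK : HasLogOn (fun z => (z - b) / (z - a)) K :=
    hasLogOn_of_isPreconnected hK.isClosed hΩc.isPreconnected hdisj hbΩ haΩ
  have hlog : HasLogOn (fun z => (z - b) / (z - a)) X := by
    refine hasLogOn_of_connectedComponentIn hXc ?_ ?_ fun x hx => ?_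
    · refine ContinuousOn.div (by fun_prop) (by fun_prop) fun z hz h0 => ?_
      exact haX (sub_eq_zero.1 h0 ▸ hz)
    · intro z hz
      exact div_ne_zero (fun h0 => hbX (sub_eq_zero.1 h0 ▸ hz))
        fun h0 => haX (sub_eq_zero.1 h0 ▸ hz)
    set Y := connectedComponentIn X x with hY
    have hYX : Y ⊆ X := connectedComponentIn_subset _ _
    have hYp : IsPreconnected Y := isPreconnected_connectedComponentIn
    by_cases hYS : (Y ∩ sphere w ε).Nonempty
    swap
    · refine hlogK.mono fun z hz => (hYX hz).resolve_right fun hzS => hYS ⟨z, hz, hzS⟩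
    have hYU : Y ∩ U' ⊆ P := by
      rintro z ⟨hzY, hzU, hzF⟩
      have hzb := hUb hzU
      have hzK : z ∈ K := (hYX hzY).resolve_right fun hzS => by
        rw [mem_ball, mem_sphere.1 hzS] at hzb; linarith
      obtain ⟨q, hqC, hqS⟩ :=
        connectedComponentIn_inter_nonempty hK isClosed_sphere hYp hYX hYS hzY hzK
      by_contra hzP
      refine hzF ⟨connectedComponentIn K z, ⟨⟨⟨z, hzK, rfl⟩, ?_⟩, ?_⟩,
        mem_connectedComponentIn hzK⟩
      · have h1 := Metric.dist_le_diam_of_mem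
          (hK.isBounded.subset (connectedComponentIn_subset _ _))
          hqC (mem_connectedComponentIn hzK)
        have h2 := dist_triangle q z w
        rw [mem_sphere] at hqS
        rw [mem_ball] at hzb
        linarith
      · exact fun h => hzP (h ▸ mem_connectedComponentIn hzK)
    have hlogP : HasLogOn (fun z => (z - b) / (z - a)) P :=
      hlogK.mono (connectedComponentIn_subset _ _)
    have hYcl : IsClosed (Y \ U') := (isClosed_connectedComponentIn hXc.isClosed x).sdiff hU'o
    have hlogY : HasLogOn (fun z => (z - b) / (z - a)) (Y \ U') :=
      hasLogOn_of_isPreconnected hYcl (convex_ball w (min δ ε)).isPreconnected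
        (disjoint_left.2 fun z hz hz' => hz'.2 (hsub hz)) hb ha
    refine (hlogP.union hlogY ?_ (Or.inl ⟨hPcl, hYcl⟩)).mono fun z hz => ?_
    · by_cases hPY : (P ∩ Y).Nonempty
      · obtain ⟨q, hqP, hqY⟩ := hPY
        have hPsub : P ⊆ Y := by
          rw [hY, connectedComponentIn_eq hqY]
          exact isPreconnected_connectedComponentIn.subset_connectedComponentIn hqP
            ((connectedComponentIn_subset _ _).trans subset_union_left)
        have : P ∩ (Y \ U') = P \ U := by
          rw [← hPU', ← inter_sdiff_assoc, inter_eq_left.2 hPsub]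
        rwa [this]
      · have : P ∩ (Y \ U') = ∅ := by
          rw [← inter_sdiff_assoc, not_nonempty_iff_eq_empty.1 hPY, empty_sdiff]
        rw [this]; exact isPreconnected_empty
    · by_cases hzU : z ∈ U'
      · exact Or.inl (hYU ⟨hz, hzU⟩)
      · exact Or.inr ⟨hz, hzU⟩
  have hmem := mem_connectedComponentIn_of_hasLogOn hXc hbX haX hlog
  set V := connectedComponentIn Xᶜ b with hV
  have hVb : b ∈ V := mem_connectedComponentIn hbX
  have hVp : IsPreconnected V := isPreconnected_connectedComponentIn
  have hVX : V ⊆ Xᶜ := connectedComponentIn_subset _ _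
  have hVΩ : V ⊆ Ω := subset_of_isPreconnected_of_disjoint_frontier hVp
    (disjoint_left.2 fun z hz hzK => hVX hz (Or.inl hzK)) ⟨b, hVb, hbΩ⟩
  have hVε : V ⊆ ball w ε := subset_of_isPreconnected_of_disjoint_frontier hVp
    (disjoint_left.2 fun z hz hzS => hVX hz (Or.inr (by rwa [frontier_ball w hε.ne'] at hzS)))
    ⟨b, hVb, ball_subset_ball (min_le_right _ _) hb⟩
  exact hVp.subset_connectedComponentIn hmem (subset_inter hVΩ hVε) hVb

/-- A homeomorphism `f` between bounded open sets, with inverse `ψ`, that is continuous up to the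
boundary. -/
structure IsBoundaryExtension (f ψ : ℂ → ℂ) (D Ω : Set ℂ) : Prop where
  isOpen_source : IsOpen D
  isOpen_target : IsOpen Ω
  isBounded_source : Bornology.IsBounded D
  continuousOn : ContinuousOn f (closure D)
  mapsTo : MapsTo f D Ω
  continuousOn_inv : ContinuousOn ψ Ω
  mapsTo_inv : MapsTo ψ Ω D
  left_inv : ∀ z ∈ D, ψ (f z) = z
  right_inv : ∀ w ∈ Ω, f (ψ w) = w

namespace IsBoundaryExtension

variable {f ψ : ℂ → ℂ} {D Ω : Set ℂ}

theorem isCompact_closure (h : IsBoundaryExtension f ψ D Ω) : IsCompact (closure D) :=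
  h.isBounded_source.isCompact_closure

theorem isCompact_frontier (h : IsBoundaryExtension f ψ D Ω) : IsCompact (frontier D) :=
  h.isCompact_closure.of_isClosed_subset isClosed_frontier frontier_subset_closure

theorem disjoint_frontier (h : IsBoundaryExtension f ψ D Ω) : Disjoint D (frontier D) := by
  rw [h.isOpen_source.frontier_eq]; exact disjoint_sdiff_right

theorem disjoint_frontier_target (h : IsBoundaryExtension f ψ D Ω) : Disjoint Ω (frontier Ω) := by
  rw [h.isOpen_target.frontier_eq]; exact disjoint_sdiff_right

theorem continuousOn_frontier (h : IsBoundaryExtension f ψ D Ω) : ContinuousOn f (frontier D) :=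
  h.continuousOn.mono frontier_subset_closure

theorem mapsTo_closure (h : IsBoundaryExtension f ψ D Ω) :
    MapsTo f (closure D) (closure Ω) :=
  h.mapsTo.closure_of_continuousOn h.continuousOn

theorem eq_inv (h : IsBoundaryExtension f ψ D Ω) {z : ℂ} (hz : z ∈ closure D) (hfz : f z ∈ Ω) :
    ψ (f z) = z := by
  have : (𝓝[D] z).NeBot := mem_closure_iff_nhdsWithin_neBot.1 hz
  have h1 : Tendsto f (𝓝[D] z) (𝓝 (f z)) := (h.continuousOn z hz).mono subset_closure
  have h2 : Tendsto (fun x => ψ (f x)) (𝓝[D] z) (𝓝 (ψ (f z))) :=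
    ((h.continuousOn_inv.continuousAt (h.isOpen_target.mem_nhds hfz)).tendsto).comp h1
  refine tendsto_nhds_unique h2
    (Tendsto.congr' (f₁ := id) ?_ (tendsto_id.mono_left nhdsWithin_le_nhds))
  filter_upwards [self_mem_nhdsWithin] with x hx
  exact (h.left_inv x hx).symm

theorem mapsTo_frontier (h : IsBoundaryExtension f ψ D Ω) :
    MapsTo f (frontier D) (frontier Ω) := by
  intro z hz
  rw [h.isOpen_target.frontier_eq]
  refine ⟨h.mapsTo_closure (frontier_subset_closure hz), fun hfz => ?_⟩
  have h1 := h.eq_inv (frontier_subset_closure hz) hfz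
  exact disjoint_left.1 h.disjoint_frontier (h1 ▸ h.mapsTo_inv hfz) hz

theorem mem_frontier_of_apply_mem (h : IsBoundaryExtension f ψ D Ω) {z : ℂ} (hz : z ∈ closure D)
    (hfz : f z ∈ frontier Ω) : z ∈ frontier D := by
  rw [h.isOpen_source.frontier_eq]
  exact ⟨hz, fun hzD => disjoint_left.1 h.disjoint_frontier_target (h.mapsTo hzD) hfz⟩

theorem surjOn_frontier (h : IsBoundaryExtension f ψ D Ω) :
    frontier Ω ⊆ f '' frontier D := by
  have hcl : closure Ω ⊆ f '' closure D :=
    closure_minimal (fun w hw => ⟨ψ w, subset_closure (h.mapsTo_inv hw), h.right_inv w hw⟩)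
      (h.isCompact_closure.image_of_continuousOn h.continuousOn).isClosed
  intro w hw
  obtain ⟨z, hz, rfl⟩ := hcl (frontier_subset_closure hw)
  exact ⟨z, h.mem_frontier_of_apply_mem hz hw, rfl⟩

theorem image_frontier (h : IsBoundaryExtension f ψ D Ω) : f '' frontier D = frontier Ω :=
  h.mapsTo_frontier.image_subset.antisymm h.surjOn_frontier

/-- The extension of a homeomorphism onto a generalized Jordan domain has connected fibres. -/
theorem isPreconnected_fiber (h : IsBoundaryExtension f ψ D Ω)
    (hΩ : IsGeneralizedJordanDomain Ω) {w : ℂ} (hw : w ∈ closure Ω) :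
    IsPreconnected (closure D ∩ f ⁻¹' {w}) := by
  by_cases hwΩ : w ∈ Ω
  · refine (subsingleton_singleton.anti (t := {ψ w}) ?_).isPreconnected
    rintro z ⟨hz, rfl⟩
    exact (h.eq_inv hz hwΩ).symm
  have hwf : w ∈ frontier Ω := by
    rw [h.isOpen_target.frontier_eq]; exact ⟨hw, hwΩ⟩
  have hFc : IsCompact (closure D ∩ f ⁻¹' {w}) :=
    h.isCompact_closure.of_isClosed_subset
      (h.continuousOn.preimage_isClosed_of_isClosed isClosed_closure isClosed_singleton)
      inter_subset_left
  rw [isPreconnected_closed_iff]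
  intro t t' ht ht' hsub hne hne'
  by_contra hempty
  obtain ⟨O, O', hO, hO', htO, htO', hOO'⟩ := SeparatedNhds.of_isCompact_isCompact
    (hFc.inter_right ht) (hFc.inter_right ht') (disjoint_left.2 fun z hz hz' =>
      hempty ⟨z, hz.1, hz.2, hz'.2⟩)
  have hR : IsCompact (closure D \ (O ∪ O')) := h.isCompact_closure.diff (hO.union hO')
  obtain ⟨ε, hε, hεR⟩ : ∃ ε > 0, ∀ z ∈ closure D \ (O ∪ O'), ε ≤ dist (f z) w := by
    rcases (closure D \ (O ∪ O')).eq_empty_or_nonempty with he | hRne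
    · exact ⟨1, one_pos, by simp [he]⟩
    obtain ⟨z₀, hz₀, hmin⟩ := hR.exists_isMinOn (f := fun z => dist (f z) w) hRne
      (continuous_id.dist continuous_const |>.comp_continuousOn (h.continuousOn.mono sdiff_subset))
    refine ⟨dist (f z₀) w, dist_pos.2 fun he => ?_, fun z hz => hmin hz⟩
    have hz₀F : z₀ ∈ closure D ∩ f ⁻¹' {w} := ⟨hz₀.1, he⟩
    rcases hsub hz₀F with hzt | hzt
    · exact hz₀.2 (Or.inl (htO ⟨hz₀F, hzt⟩))
    · exact hz₀.2 (Or.inr (htO' ⟨hz₀F, hzt⟩))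
  obtain ⟨δ, hδ, hδε, hLC⟩ := hΩ.exists_mem_connectedComponentIn_inter_ball hwf hε
  have happ : ∀ T : Set ℂ, IsOpen T → ((closure D ∩ f ⁻¹' {w}) ∩ T).Nonempty →
      ∃ z ∈ D, z ∈ T ∧ f z ∈ ball w δ := by
    rintro T hT ⟨z, ⟨hz, hzw⟩, hzT⟩
    have : (𝓝[D] z).NeBot := mem_closure_iff_nhdsWithin_neBot.1 hz
    have h1 : Tendsto f (𝓝[D] z) (𝓝 w) := by
      rw [← show f z = w from hzw]; exact (h.continuousOn z hz).mono subset_closure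
    have hT' : ∀ᶠ x in 𝓝[D] z, x ∈ T := mem_nhdsWithin_of_mem_nhds (hT.mem_nhds hzT)
    obtain ⟨x, ⟨hx, hxT⟩, hxD⟩ := (((h1.eventually (ball_mem_nhds w hδ)).and hT').and
      eventually_mem_nhdsWithin).exists
    exact ⟨x, hxD, hxT, hx⟩
  obtain ⟨p, hpD, hpO, hpδ⟩ := happ O hO
    (hne.mono fun z hz => ⟨hz.1, htO hz⟩)
  obtain ⟨q, hqD, hqO, hqδ⟩ := happ O' hO'
    (hne'.mono fun z hz => ⟨hz.1, htO' hz⟩)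
  set V := connectedComponentIn (Ω ∩ ball w ε) (f p) with hV
  have hVs : V ⊆ Ω ∩ ball w ε := connectedComponentIn_subset _ _
  have hpV : f p ∈ V := mem_connectedComponentIn ⟨h.mapsTo hpD, ball_subset_ball hδε hpδ⟩
  have hqV : f q ∈ V := hLC _ ⟨h.mapsTo hpD, hpδ⟩ _ ⟨h.mapsTo hqD, hqδ⟩
  have hψV : IsPreconnected (ψ '' V) := isPreconnected_connectedComponentIn.image _
    (h.continuousOn_inv.mono fun z hz => (hVs hz).1)
  obtain ⟨z, -, hzO, hzO'⟩ := hψV O O' hO hO' (by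
    rintro _ ⟨v, hv, rfl⟩
    by_contra hvO
    have := hεR (ψ v) ⟨subset_closure (h.mapsTo_inv (hVs hv).1), hvO⟩
    rw [h.right_inv v (hVs hv).1] at this
    exact this.not_gt (hVs hv).2) ⟨p, ⟨f p, hpV, h.left_inv p hpD⟩, hpO⟩
    ⟨q, ⟨f q, hqV, h.left_inv q hqD⟩, hqO⟩
  exact disjoint_left.1 hOO' hzO hzO'

end IsBoundaryExtension

theorem hasLogOn_sub_sphere {a b : ℂ} {r : ℝ} (hr : r < dist a b) :
    HasLogOn (fun z => z - b) (sphere a r) := by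
  by_cases hr0 : r < 0
  · rw [sphere_eq_empty_of_neg hr0]; exact ⟨fun _ => 0, by simp, by simp⟩
  have hab : a - b ≠ 0 := fun h => by
    rw [sub_eq_zero.1 h, dist_self] at hr
    exact hr0 hr
  have hmem : ∀ z ∈ sphere a r, (z - b) / (a - b) ∈ Complex.slitPlane := fun z hz => by
    have h1 : (z - b) / (a - b) = 1 + (z - a) / (a - b) := by field_simp; ring
    rw [h1]
    apply Complex.mem_slitPlane_of_norm_lt_one
    rw [norm_div, div_lt_one (norm_pos_iff.2 hab)]
    rwa [mem_sphere_iff_norm.1 hz, ← dist_eq_norm]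
  refine ⟨fun z => Complex.log ((z - b) / (a - b)) + Complex.log (a - b),
    (ContinuousOn.clog (by fun_prop) hmem).add continuousOn_const, fun z hz => ?_⟩
  rw [Complex.exp_add, Complex.exp_log (Complex.slitPlane_ne_zero (hmem z hz)),
    Complex.exp_log hab, div_mul_cancel₀ _ hab]

/-- A Jordan curve separates the plane. -/
theorem IsLoopParam.not_isPreconnected_compl {γ : ℝ → ℂ} {J : Set ℂ} (hγ : IsLoopParam γ J) :
    ¬ IsPreconnected Jᶜ := by
  intro hJ
  have hτ : (1 / 2 : ℝ) ∈ Icc (0 : ℝ) 1 := by constructor <;> norm_num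
  have hab : γ 0 ≠ γ (1 / 2) := fun h => by
    have := (hγ.eq_zero_and_eq_one le_rfl (by norm_num) hτ.2 h).2
    norm_num at this
  have hcont : ∀ u v : ℝ, Continuous fun t : unitInterval => γ (u + v * t) := fun u v =>
    hγ.continuous.comp (by fun_prop)
  have h1 : HasLogOn (fun z => (z - γ (1 / 2)) / (z - γ 0)) (γ '' Icc 0 (1 / 2))ᶜ := by
    have := hasLogOn_of_path (X := (γ '' Icc 0 (1 / 2))ᶜ) (hcont 0 (1 / 2)) fun t ht =>
      ht (mem_image_of_mem _ ⟨by linarith [t.2.1], by linarith [t.2.2]⟩)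
    simpa using this
  have h2 : HasLogOn (fun z => (z - γ (1 / 2)) / (z - γ 0)) (γ '' Icc (1 / 2) 1)ᶜ := by
    have := hasLogOn_of_path (X := (γ '' Icc (1 / 2) 1)ᶜ) (hcont 1 (-1 / 2)) fun t ht =>
      ht (mem_image_of_mem _ ⟨by linarith [t.2.2], by linarith [t.2.1]⟩)
    rw [hγ.eq_endpoints]
    convert this using 4 <;> norm_num
  have h3 := h1.union h2 (by rwa [← compl_union, hγ.image_Icc_union hτ])
    (Or.inr ⟨(hγ.isCompact_image _ _).isClosed.isOpen_compl,
      (hγ.isCompact_image _ _).isClosed.isOpen_compl⟩)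
  rw [← compl_inter, hγ.image_Icc_inter hτ] at h3
  have hd : 0 < dist (γ 0) (γ (1 / 2)) := dist_pos.2 hab
  have hsub : sphere (γ 0) (dist (γ 0) (γ (1 / 2)) / 2) ⊆ {γ 0, γ (1 / 2)}ᶜ := by
    rintro z hz (rfl | rfl)
    · rw [mem_sphere, dist_self] at hz; linarith
    · rw [mem_sphere, dist_comm] at hz; linarith
  refine not_hasLogOn_sphere (γ 0) (half_pos hd)
    (((hasLogOn_sub_sphere (half_lt_self hd)).mul (h3.mono hsub).inv).congr fun z hz => ?_)
  have hz1 : z - γ (1 / 2) ≠ 0 := fun h => hsub hz (Or.inr (sub_eq_zero.1 h))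
  have hz0 : z - γ 0 ≠ 0 := fun h => hsub hz (Or.inl (sub_eq_zero.1 h))
  field_simp

/-- Every complementary component of a Jordan curve accumulates at every point of the curve. -/
theorem IsLoopParam.mem_closure_connectedComponentIn {γ : ℝ → ℂ} {J : Set ℂ}
    (hγ : IsLoopParam γ J) {o p : ℂ} (ho : o ∉ J) (hp : p ∉ J)
    (hpo : p ∉ connectedComponentIn Jᶜ o) : γ 0 ∈ closure (connectedComponentIn Jᶜ o) := by
  set V := connectedComponentIn Jᶜ o with hV
  by_contra hcl
  obtain ⟨r, hr, hrV⟩ := Metric.isOpen_iff.1 isClosed_closure.isOpen_compl _ hcl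
  obtain ⟨σ, hσ0, hσ2, hσ⟩ := hγ.exists_sdiff_ball_subset hr
  have hAJ : γ '' Icc σ (1 - σ) ⊆ J := hγ.image_subset hσ0.le (by linarith)
  have hfr : frontier V ⊆ γ '' Icc σ (1 - σ) := fun z hz => hσ
    ⟨by simpa using frontier_connectedComponentIn_subset hγ.isCompact.isClosed.isOpen_compl o hz,
      fun hzb => hrV hzb (frontier_subset_closure hz)⟩
  have hp' : ∀ z ∈ γ '' Icc σ (1 - σ), z - p ≠ 0 := fun z hz h =>
    hp (hAJ (by rwa [← sub_eq_zero.1 h]))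
  have ho' : ∀ z ∈ γ '' Icc σ (1 - σ), z - o ≠ 0 := fun z hz h =>
    ho (hAJ (by rwa [← sub_eq_zero.1 h]))
  have hlog : HasLogOn (fun z => (z - o) / (z - p)) (γ '' Icc σ (1 - σ)) :=
    hasLogOn_arc hγ.continuous (by linarith) (hγ.injOn_Icc hσ0.le (by linarith) (Or.inl hσ0))
      (ContinuousOn.div (by fun_prop) (by fun_prop) hp') fun z hz =>
        div_ne_zero (ho' z hz) (hp' z hz)
  have hmem := mem_connectedComponentIn_of_hasLogOn (hγ.isCompact_image _ _)
    (fun h => ho (hAJ h)) (fun h => hp (hAJ h)) hlog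
  refine hpo (subset_of_isPreconnected_of_disjoint_frontier isPreconnected_connectedComponentIn
    (disjoint_left.2 fun z hz hzV =>
      connectedComponentIn_subset (γ '' Icc σ (1 - σ))ᶜ _ hz (hfr hzV))
    ⟨o, mem_connectedComponentIn (F := (γ '' Icc σ (1 - σ))ᶜ) (fun h => ho (hAJ h)),
      mem_connectedComponentIn ho⟩ hmem)

/-- A Jordan curve `J` disjoint from a connected set `D` has a complementary component that is
disjoint from `D` and accumulates at every point of `J`. -/
theorem IsJordanCurve.exists_connectedComponentIn_disjoint {J D : Set ℂ} (hJ : IsJordanCurve J)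
    (hJD : Disjoint D J) (hD : IsConnected D) (hne : J.Nonempty) : ∃ o ∉ J,
      Disjoint (connectedComponentIn Jᶜ o) D ∧ J ⊆ closure (connectedComponentIn Jᶜ o) := by
  obtain ⟨p, hp⟩ := hD.nonempty
  have hDJ : D ⊆ Jᶜ := hJD.subset_compl_right
  have hDp : D ⊆ connectedComponentIn Jᶜ p := hD.isPreconnected.subset_connectedComponentIn hp hDJ
  obtain ⟨a, ha⟩ := hne
  obtain ⟨γ, hγ, -⟩ := hJ.exists_isLoopParam ha
  obtain ⟨o, ho, hop⟩ : ∃ o ∈ Jᶜ, o ∉ connectedComponentIn Jᶜ p := by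
    by_contra! h
    refine hγ.not_isPreconnected_compl ?_
    rw [← (connectedComponentIn_subset Jᶜ p).antisymm h]
    exact isPreconnected_connectedComponentIn
  have hdisj : Disjoint (connectedComponentIn Jᶜ o) D := disjoint_left.2 fun z hz hzD => hop <| by
    rw [connectedComponentIn_eq (hDp hzD), ← connectedComponentIn_eq hz]
    exact mem_connectedComponentIn ho
  refine ⟨o, ho, hdisj, fun b hb => ?_⟩
  obtain ⟨γ, hγ, rfl⟩ := hJ.exists_isLoopParam hb
  exact hγ.mem_closure_connectedComponentIn ho (hDJ hp) fun h => disjoint_left.1 hdisj h hp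

theorem exists_isCompact_isConnected_subset {U : Set ℂ} (hU : IsOpen U) (hUc : IsPreconnected U)
    {x y : ℂ} (hx : x ∈ U) (hy : y ∈ U) :
    ∃ C ⊆ U, IsCompact C ∧ IsConnected C ∧ x ∈ C ∧ y ∈ C := by
  have := (hU.isConnected_iff_isPathConnected.1 ⟨⟨x, hx⟩, hUc⟩).joinedIn x hx y hy
  refine ⟨range this.somePath, range_subset_iff.2 this.somePath_mem,
    isCompact_range this.somePath.continuous, isConnected_range this.somePath.continuous,
    ⟨0, by simp⟩, ⟨1, by simp⟩⟩

/-- Boundary points of a generalized Jordan domain are accessible. -/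
theorem IsGeneralizedJordanDomain.exists_isCompact_isConnected {D : Set ℂ}
    (hD : IsGeneralizedJordanDomain D) {a : ℂ} (ha : a ∈ frontier D) :
    ∃ K, IsCompact K ∧ IsConnected K ∧ a ∈ K ∧ K ⊆ insert a D ∧ (K ∩ D).Nonempty := by
  have hDo : IsOpen D := hD.1.2.1
  choose δ hδ hδε hLC using fun n : ℕ =>
    hD.exists_mem_connectedComponentIn_inter_ball ha (ε := 1 / ((n : ℝ) + 1)) (by positivity)
  have hx : ∀ n, ∃ x ∈ D, x ∈ ball a (min (δ n) (δ (n - 1))) := fun n => by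
    obtain ⟨x, hx, hxD⟩ := mem_closure_iff.1 (frontier_subset_closure ha) _ isOpen_ball
      (mem_ball_self (lt_min (hδ n) (hδ (n - 1))))
    exact ⟨x, hxD, hx⟩
  choose x hxD hxδ using hx
  have hx1 : ∀ n, x n ∈ D ∩ ball a (δ n) := fun n =>
    ⟨hxD n, ball_subset_ball (min_le_left _ _) (hxδ n)⟩
  have hx2 : ∀ n, x (n + 1) ∈ D ∩ ball a (δ n) := fun n =>
    ⟨hxD _, ball_subset_ball (min_le_right _ _) (hxδ (n + 1))⟩
  have hC : ∀ n : ℕ, ∃ C ⊆ D ∩ ball a (1 / ((n : ℝ) + 1)),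
      IsCompact C ∧ IsConnected C ∧ x n ∈ C ∧ x (n + 1) ∈ C := fun n => by
    obtain ⟨C, hC, h⟩ := exists_isCompact_isConnected_subset
      (U := connectedComponentIn (D ∩ ball a (1 / ((n : ℝ) + 1))) (x n))
      (hDo.inter isOpen_ball).connectedComponentIn isPreconnected_connectedComponentIn
      (mem_connectedComponentIn ⟨hxD n, ball_subset_ball (hδε n) (hx1 n).2⟩)
      (hLC n _ (hx1 n) _ (hx2 n))
    exact ⟨C, hC.trans (connectedComponentIn_subset _ _), h⟩
  choose C hCs hCc hCconn hxC hxC' using hC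
  have hconn : IsConnected (⋃ n, C n) :=
    IsConnected.iUnion_of_chain hCconn fun n => ⟨x (n + 1), hxC' n, hxC (n + 1)⟩
  have haC : a ∈ closure (⋃ n, C n) := by
    rw [Metric.mem_closure_iff]
    intro ε hε
    obtain ⟨n, hn⟩ := exists_nat_one_div_lt hε
    exact ⟨x n, mem_iUnion_of_mem n (hxC n), by
      rw [dist_comm]; exact (mem_ball.1 (hCs n (hxC n)).2).trans hn⟩
  have hcl : closure (⋃ n, C n) ⊆ insert a (⋃ n, C n) := by
    intro z hz
    by_cases hza : z = a
    · exact Or.inl hza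
    obtain ⟨N, hN⟩ := exists_nat_one_div_lt (dist_pos.2 hza)
    have hfin : IsClosed (⋃ n ∈ Finset.range N, C n) :=
      isClosed_biUnion_finset fun n _ => (hCc n).isClosed
    have hsub : (⋃ n, C n) ⊆ (⋃ n ∈ Finset.range N, C n) ∪ closedBall a (1 / ((N : ℝ) + 1)) := by
      refine iUnion_subset fun n => ?_
      by_cases hn : n < N
      · exact (subset_biUnion_of_mem (u := C) (by simpa using hn)).trans subset_union_left
      · refine fun z hz => Or.inr ((mem_ball.1 (hCs n hz).2).le.trans ?_)
        push Not at hn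
        gcongr
    rcases closure_minimal hsub (hfin.union isClosed_closedBall) hz with h | h
    · exact Or.inr (iUnion₂_subset_iUnion _ _ h)
    · exact absurd (mem_closedBall.1 h) hN.not_ge
  have hK : closure (⋃ n, C n) = insert a (⋃ n, C n) :=
    hcl.antisymm (insert_subset haC subset_closure)
  have hCD : (⋃ n, C n) ⊆ D := iUnion_subset fun n z hz => (hCs n hz).1
  refine ⟨closure (⋃ n, C n), (hD.2.1.subset hCD).isCompact_closure, hconn.closure, haC, ?_,
    ⟨x 0, subset_closure (mem_iUnion_of_mem 0 (hxC 0)), hxD 0⟩⟩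
  rw [hK]
  exact insert_subset_insert hCD

theorem IsGeneralizedJordanDomain.exists_crosscut {D : Set ℂ}
    (hD : IsGeneralizedJordanDomain D) {a b : ℂ} (ha : a ∈ frontier D) (hb : b ∈ frontier D) :
    ∃ α, IsCompact α ∧ IsConnected α ∧ a ∈ α ∧ b ∈ α ∧ α ⊆ {a, b} ∪ D := by
  obtain ⟨K, hK, hKc, haK, hKs, p, hpK, hpD⟩ := hD.exists_isCompact_isConnected ha
  obtain ⟨M, hM, hMc, hbM, hMs, q, hqM, hqD⟩ := hD.exists_isCompact_isConnected hb
  obtain ⟨C, hCD, hC, hCc, hpC, hqC⟩ := exists_isCompact_isConnected_subset hD.1.2.1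
    hD.1.2.2.isPreconnected hpD hqD
  refine ⟨K ∪ C ∪ M, (hK.union hC).union hM,
    (hKc.union ⟨p, hpK, hpC⟩ hCc).union ⟨q, Or.inr hqC, hqM⟩ hMc, Or.inl (Or.inl haK), Or.inr hbM,
    union_subset (union_subset ?_ ?_) ?_⟩
  · exact fun z hz => (hKs hz).imp Or.inl id
  · exact fun z hz => Or.inr (hCD hz)
  · exact fun z hz => (hMs hz).imp Or.inr id

namespace IsBoundaryExtension

variable {f ψ : ℂ → ℂ} {D Ω : Set ℂ}

/-- Points of `D` that a compact connected set `α` meeting `∂D` in one fibre need not separate. -/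
theorem exists_isPreconnected_sdiff (h : IsBoundaryExtension f ψ D Ω) (hΩ : IsPreconnected Ω)
    {α : Set ℂ} (hα : IsCompact α) (hαD : α ⊆ closure D) {y : ℂ}
    (hαy : ∀ z ∈ α, z ∈ frontier D → f z = y) {b₁ b₂ : ℂ} (hb₁ : b₁ ∈ frontier D)
    (hb₂ : b₂ ∈ frontier D) (hbb : f b₁ = f b₂) (hby : f b₁ ≠ y) {r : ℝ} (hr : 0 < r) :
    ∃ β ⊆ D \ α, IsPreconnected β ∧ (β ∩ ball b₁ r).Nonempty ∧ (β ∩ ball b₂ r).Nonempty := by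
  set A := f '' α with hA
  have hAc : IsCompact A := hα.image_of_continuousOn (h.continuousOn.mono hαD)
  have hK : IsCompact (frontier Ω) := h.image_frontier ▸
    h.isCompact_frontier.image_of_continuousOn h.continuousOn_frontier
  have hxΩ : f b₁ ∈ frontier Ω := h.mapsTo_frontier hb₁
  have hAy : A ∩ frontier Ω ⊆ {y} := by
    rintro _ ⟨⟨z, hz, rfl⟩, hzΩ⟩
    exact hαy z hz (h.mem_frontier_of_apply_mem (hαD hz) hzΩ)
  have hxA : f b₁ ∉ A := fun hxA => hby (hAy ⟨hxA, hxΩ⟩)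
  obtain ⟨ρ, hρ, hρA⟩ := Metric.isOpen_iff.1 hAc.isClosed.isOpen_compl _ hxA
  have happ : ∀ b ∈ frontier D, f b = f b₁ → ∃ p ∈ D, p ∈ ball b r ∧ f p ∈ ball (f b₁) ρ := by
    intro b hb hbf
    have hbc := frontier_subset_closure hb
    have : (𝓝[D] b).NeBot := mem_closure_iff_nhdsWithin_neBot.1 hbc
    have h1 : Tendsto f (𝓝[D] b) (𝓝 (f b₁)) := by
      rw [← hbf]; exact (h.continuousOn b hbc).mono subset_closure
    have h2 : ∀ᶠ x in 𝓝[D] b, x ∈ ball b r := mem_nhdsWithin_of_mem_nhds (ball_mem_nhds b hr)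
    obtain ⟨x, ⟨hx, hxr⟩, hxD⟩ := (((h1.eventually (ball_mem_nhds _ hρ)).and h2).and
      eventually_mem_nhdsWithin).exists
    exact ⟨x, hxD, hxr, hx⟩
  obtain ⟨p₁, hp₁D, hp₁r, hp₁⟩ := happ b₁ hb₁ rfl
  obtain ⟨p₂, hp₂D, hp₂r, hp₂⟩ := happ b₂ hb₂ hbb.symm
  have hX : IsCompact (A ∪ frontier Ω) := hAc.union hK
  have hΩK := h.disjoint_frontier_target
  have hnX : ∀ p ∈ D, f p ∈ ball (f b₁) ρ → f p ∉ A ∪ frontier Ω := by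
    rintro p hp hpρ (hpA | hpK)
    · exact hρA hpρ hpA
    · exact disjoint_left.1 hΩK (h.mapsTo hp) hpK
  have hlogA : HasLogOn (fun z => (z - f p₂) / (z - f p₁)) A :=
    hasLogOn_of_isPreconnected hAc.isClosed (convex_ball (f b₁) ρ).isPreconnected
      (subset_compl_iff_disjoint_right.1 hρA) hp₂ hp₁
  have hlogK : HasLogOn (fun z => (z - f p₂) / (z - f p₁)) (frontier Ω) :=
    hasLogOn_of_isPreconnected hK.isClosed hΩ hΩK (h.mapsTo hp₂D) (h.mapsTo hp₁D)
  have hmem := mem_connectedComponentIn_of_hasLogOn hX (hnX p₂ hp₂D hp₂) (hnX p₁ hp₁D hp₁)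
    (hlogA.union hlogK (subsingleton_singleton.anti hAy).isPreconnected
      (Or.inl ⟨hAc.isClosed, hK.isClosed⟩))
  set W := connectedComponentIn (A ∪ frontier Ω)ᶜ (f p₂) with hW
  have hWX : W ⊆ (A ∪ frontier Ω)ᶜ := connectedComponentIn_subset _ _
  have hpW : f p₂ ∈ W := mem_connectedComponentIn (hnX p₂ hp₂D hp₂)
  have hWp : IsPreconnected W := isPreconnected_connectedComponentIn
  have hWΩ : W ⊆ Ω := subset_of_isPreconnected_of_disjoint_frontier hWp
    (disjoint_left.2 fun z hz hzK => hWX hz (Or.inr hzK)) ⟨_, hpW, h.mapsTo hp₂D⟩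
  refine ⟨ψ '' W, ?_, hWp.image _ (h.continuousOn_inv.mono hWΩ),
    ⟨p₁, ⟨f p₁, hmem, h.left_inv p₁ hp₁D⟩, hp₁r⟩, ⟨p₂, ⟨f p₂, hpW, h.left_inv p₂ hp₂D⟩, hp₂r⟩⟩
  rintro _ ⟨w, hw, rfl⟩
  refine ⟨h.mapsTo_inv (hWΩ hw), fun hwα => hWX hw (Or.inl ?_)⟩
  exact ⟨ψ w, hwα, h.right_inv w (hWΩ hw)⟩

/-- Two complementary arcs of a boundary curve, with common endpoints in one fibre, cannot both
meet another fibre. -/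
theorem not_exists_crossing (h : IsBoundaryExtension f ψ D Ω) (hD : IsGeneralizedJordanDomain D)
    (hΩ : IsPreconnected Ω) {γ : ℝ → ℂ} {Q : Set ℂ} (hγ : IsLoopParam γ Q)
    (hQ : IsJordanCurve Q) (hQD : Q ⊆ frontier D)
    {s₁ τ s₂ : ℝ} (hs₁ : s₁ ∈ Icc 0 τ) (hs₂ : s₂ ∈ Icc τ 1) (hτ : f (γ τ) = f (γ 0))
    (hs : f (γ s₁) = f (γ s₂)) : f (γ s₁) = f (γ 0) := by
  by_contra hne
  have hτ01 : τ ∈ Icc (0 : ℝ) 1 := ⟨hs₁.1.trans hs₁.2, hs₂.1.trans hs₂.2⟩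
  have hDQ : Disjoint D Q := h.disjoint_frontier.mono_right hQD
  have h0Q : γ 0 ∈ Q := hγ.mem ⟨le_rfl, zero_le_one⟩
  obtain ⟨α, hα, hαc, h0α, hτα, hαs⟩ := hD.exists_crosscut (hQD h0Q) (hQD (hγ.mem hτ01))
  have hα_eq : ∀ z ∈ α, z ∈ frontier D → z = γ 0 ∨ z = γ τ := fun z hz hzD =>
    (hαs hz).resolve_right fun hzD' => disjoint_left.1 h.disjoint_frontier hzD' hzD
  have hαy : ∀ z ∈ α, z ∈ frontier D → f z = f (γ 0) := by
    intro z hz hzD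
    rcases hα_eq z hz hzD with rfl | rfl
    · rfl
    · exact hτ
  have hαD : α ⊆ closure D := hαs.trans <| union_subset (insert_subset
    (frontier_subset_closure (hQD h0Q)) (singleton_subset_iff.2
      (frontier_subset_closure (hQD (hγ.mem hτ01))))) subset_closure
  have hb₁Q : γ s₁ ∈ Q := hγ.mem ⟨hs₁.1, hs₁.2.trans hτ01.2⟩
  have hb₂Q : γ s₂ ∈ Q := hγ.mem ⟨hτ01.1.trans hs₂.1, hs₂.2⟩
  obtain ⟨o, hoQ, hVD, hQV⟩ := hQ.exists_connectedComponentIn_disjoint hDQ hD.1.2.2 ⟨_, h0Q⟩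
  set V := connectedComponentIn Qᶜ o with hV
  have hVQ : V ⊆ Qᶜ := connectedComponentIn_subset _ _
  have hVp : IsPreconnected V := isPreconnected_connectedComponentIn
  have hVα : Disjoint V α := disjoint_left.2 fun z hz hzα => by
    rcases hαs hzα with (rfl | rfl) | hzD
    · exact hVQ hz h0Q
    · exact hVQ hz (hγ.mem hτ01)
    · exact disjoint_left.1 hVD hz hzD
  have hinter := hγ.image_Icc_inter hτ01
  have hnot : ∀ b, f b = f (γ s₁) → b ∉ ({γ 0, γ τ} : Set ℂ) := by
    rintro b hb (rfl | rfl)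
    · exact hne hb.symm
    · exact hne (hb.symm.trans hτ)
  set Q₁ := γ '' Icc 0 τ with hQ₁
  set Q₂ := γ '' Icc τ 1 with hQ₂
  have hQ₁Q : Q₁ ⊆ Q := hγ.image_subset le_rfl hτ01.2
  have hQ₂Q : Q₂ ⊆ Q := hγ.image_subset hτ01.1 le_rfl
  have hc₁ : IsClosed (Q₁ ∪ α) := ((hγ.isCompact_image _ _).union hα).isClosed
  have hc₂ : IsClosed (Q₂ ∪ α) := ((hγ.isCompact_image _ _).union hα).isClosed
  have hb₁n : γ s₁ ∉ Q₂ ∪ α := by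
    rintro (hb | hb)
    · exact hnot _ rfl (hinter ▸ ⟨mem_image_of_mem γ hs₁, hb⟩)
    · exact hne (hαy _ hb (hQD hb₁Q))
  have hb₂n : γ s₂ ∉ Q₁ ∪ α := by
    rintro (hb | hb)
    · exact hnot _ hs.symm (hinter ▸ ⟨hb, mem_image_of_mem γ hs₂⟩)
    · exact hne (hs.trans (hαy _ hb (hQD hb₂Q)))
  obtain ⟨r₁, hr₁, hr₁s⟩ := Metric.isOpen_iff.1 hc₂.isOpen_compl _ hb₁n
  obtain ⟨r₂, hr₂, hr₂s⟩ := Metric.isOpen_iff.1 hc₁.isOpen_compl _ hb₂n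
  obtain ⟨β, hβD, hβp, hβ₁, hβ₂⟩ := h.exists_isPreconnected_sdiff hΩ hα hαD hαy (hQD hb₁Q)
    (hQD hb₂Q) hs hne (lt_min hr₁ hr₂)
  obtain ⟨p, hpβ⟩ : β.Nonempty := hβ₁.mono inter_subset_left
  have hpQ : p ∉ Q := fun hpQ => disjoint_left.1 hDQ (hβD hpβ).1 hpQ
  have key : ∀ R ⊆ Q, IsClosed (R ∪ α) → ∀ b ∈ Q, ∀ r > 0, ball b r ⊆ (R ∪ α)ᶜ →
      (β ∩ ball b r).Nonempty → HasLogOn (fun z => (z - p) / (z - o)) (R ∪ α) := by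
    intro R hRQ hR b hb r hr hbr hβ
    have hVb : (V ∩ ball b r).Nonempty := by
      rw [inter_comm]
      exact mem_closure_iff.1 (hQV hb) _ isOpen_ball (mem_ball_self hr)
    obtain ⟨q, hqV, hqb⟩ := hVb
    obtain ⟨q', hqβ, hqb'⟩ := hβ
    refine hasLogOn_of_isPreconnected hR ((hVp.union q hqV hqb
      (convex_ball b r).isPreconnected).union q' (Or.inr hqb') hqβ hβp) ?_ (Or.inr hpβ)
      (Or.inl (Or.inl (mem_connectedComponentIn hoQ)))
    refine disjoint_left.2 ?_
    rintro z ((hz | hz) | hz) hzR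
    · rcases hzR with hzR | hzα
      · exact hVQ hz (hRQ hzR)
      · exact disjoint_left.1 hVα hz hzα
    · exact hbr hz hzR
    · rcases hzR with hzR | hzα
      · exact disjoint_left.1 hDQ (hβD hz).1 (hRQ hzR)
      · exact (hβD hz).2 hzα
  have hlog₁ := key Q₁ hQ₁Q hc₁ _ hb₂Q r₂ hr₂ hr₂s
    (hβ₂.mono (inter_subset_inter_right _ (ball_subset_ball (min_le_right _ _))))
  have hlog₂ := key Q₂ hQ₂Q hc₂ _ hb₁Q r₁ hr₁ hr₁s
    (hβ₁.mono (inter_subset_inter_right _ (ball_subset_ball (min_le_left _ _))))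
  have hlog : HasLogOn (fun z => (z - p) / (z - o)) Q := by
    refine (hlog₁.union hlog₂ ?_ (Or.inl ⟨hc₁, hc₂⟩)).mono fun z hz => ?_
    · rw [← inter_union_distrib_right, hinter, union_eq_right.2]
      · exact hαc.isPreconnected
      · exact insert_subset h0α (singleton_subset_iff.2 hτα)
    · rw [← hγ.image_Icc_union hτ01] at hz
      exact hz.imp Or.inl Or.inl
  have hmem := mem_connectedComponentIn_of_hasLogOn hγ.isCompact hpQ hoQ hlog
  have hpV : p ∈ V := by
    rw [hV, ← connectedComponentIn_eq hmem]; exact mem_connectedComponentIn hpQ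
  exact disjoint_left.1 hVD hpV (hβD hpβ).1

theorem nonAlternatingOn (h : IsBoundaryExtension f ψ D Ω) (hD : IsGeneralizedJordanDomain D)
    (hΩ : IsPreconnected Ω) {x₀ : ℂ} (hx₀ : x₀ ∈ frontier D) :
    NonAlternatingOn f (connectedComponentIn (frontier D) x₀)
      (f '' connectedComponentIn (frontier D) x₀) := by
  rintro ⟨x, -, y, -, A₁, A₂, -, -, hdisj, hun, ⟨U₁, hU₁, hA₁⟩, ⟨U₂, hU₂, hA₂⟩,
    ⟨a₁, ha₁, hy₁⟩, ⟨a₂, ha₂, hy₂⟩⟩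
  set Q := connectedComponentIn (frontier D) x₀ with hQ
  have hQD : Q ⊆ frontier D := connectedComponentIn_subset _ _
  have ha₁Q : a₁ ∈ Q ∧ f a₁ ≠ x := by
    have : a₁ ∈ A₁ ∪ A₂ := Or.inl ha₁
    rwa [hun] at this
  have ha₂Q : a₂ ∈ Q ∧ f a₂ ≠ x := by
    have : a₂ ∈ A₁ ∪ A₂ := Or.inr ha₂
    rwa [hun] at this
  have hmeet : ∀ S ⊆ Q, IsPreconnected S → a₁ ∈ S → a₂ ∈ S → ∃ b ∈ S, f b = x := by
    intro S hSQ hS h1 h2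
    by_contra! hSx
    have hSU : ∀ z ∈ S, z ∈ A₁ ∪ A₂ := fun z hz => by
      rw [hun]; exact ⟨hSQ hz, hSx z hz⟩
    obtain ⟨z, hz, hz1, hz2⟩ := hS U₁ U₂ hU₁ hU₂
      (fun z hz => (hSU z hz).imp (fun hz' => (hA₁ ▸ hz').1) fun hz' => (hA₂ ▸ hz').1)
      ⟨a₁, h1, (hA₁ ▸ ha₁).1⟩ ⟨a₂, h2, (hA₂ ▸ ha₂).1⟩
    exact disjoint_left.1 hdisj (hA₁ ▸ ⟨hz1, hSQ hz, hSx z hz⟩ : z ∈ A₁)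
      (hA₂ ▸ ⟨hz2, hSQ hz, hSx z hz⟩ : z ∈ A₂)
  rcases hD.2.2.2 x₀ hx₀ with hQs | hQJ
  · have h1 : a₁ ∈ ({x₀} : Set ℂ) := hQs ▸ ha₁Q.1
    have h2 : a₂ ∈ ({x₀} : Set ℂ) := hQs ▸ ha₂Q.1
    exact disjoint_left.1 hdisj ha₁ ((h1.trans h2.symm : a₁ = a₂) ▸ ha₂)
  obtain ⟨γ, hγ, rfl⟩ := hQJ.exists_isLoopParam ha₁Q.1
  obtain ⟨τ, hτ, rfl⟩ := hγ.exists_eq ha₂Q.1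
  obtain ⟨_, ⟨s₁, hs₁, rfl⟩, hx₁⟩ := hmeet (γ '' Icc 0 τ) (hγ.image_subset le_rfl hτ.2)
    (hγ.isPreconnected_image ordConnected_Icc) ⟨0, ⟨le_rfl, hτ.1⟩, rfl⟩ ⟨τ, ⟨hτ.1, le_rfl⟩, rfl⟩
  obtain ⟨_, ⟨s₂, hs₂, rfl⟩, hx₂⟩ := hmeet (γ '' Icc τ 1) (hγ.image_subset hτ.1 le_rfl)
    (hγ.isPreconnected_image ordConnected_Icc) ⟨1, ⟨hτ.2, le_rfl⟩, hγ.eq_endpoints.symm⟩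
    ⟨τ, ⟨le_rfl, hτ.2⟩, rfl⟩
  refine ha₁Q.2 ?_
  rw [← hx₁]
  exact (h.not_exists_crossing hD hΩ hγ hQJ hQD hs₁ hs₂ (hy₂.trans hy₁.symm)
    (hx₁.trans hx₂.symm)).symm

end IsBoundaryExtension

theorem exists_running_sup {F : ℝ → ℂ} (hF : Continuous F) {M : ℝ}
    (hM : ∀ s t, dist (F s) (F t) ≤ M) (p : ℝ) : ∃ h : ℝ → ℝ, Continuous h ∧
      (∀ t, ∀ r ∈ Icc p t, dist (F r) (F p) ≤ h t) ∧ (∀ t, 0 ≤ h t) ∧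
      ∀ t c, 0 ≤ c → (∀ r ∈ Icc p t, dist (F r) (F p) ≤ c) → h t ≤ c := by
  have hbdd : ∀ t, BddAbove ((fun u => dist (F (p + u * max (t - p) 0)) (F p)) '' Icc (0 : ℝ) 1) :=
    fun t => ⟨M, by rintro _ ⟨u, -, rfl⟩; exact hM _ _⟩
  refine ⟨fun t => sSup ((fun u => dist (F (p + u * max (t - p) 0)) (F p)) '' Icc (0 : ℝ) 1),
    isCompact_Icc.continuous_sSup ?_, fun t r hr => ?_, fun t => ?_, fun t c hc hr => ?_⟩
  · exact (hF.comp (by fun_prop)).dist continuous_const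
  · rcases hr.1.eq_or_lt with rfl | hpr
    · refine le_csSup (hbdd t) ⟨0, ⟨le_rfl, zero_le_one⟩, by simp⟩
    · have hpt : 0 < t - p := by linarith [hr.2]
      refine le_csSup (hbdd t) ⟨(r - p) / (t - p), ⟨?_, ?_⟩, ?_⟩
      · exact div_nonneg (by linarith) hpt.le
      · rw [div_le_one hpt]; linarith [hr.2]
      · simp only [max_eq_left hpt.le, div_mul_cancel₀ _ hpt.ne', add_sub_cancel]
  · exact le_csSup (hbdd t) ⟨0, ⟨le_rfl, zero_le_one⟩, by simp⟩
  · refine csSup_le ((nonempty_Icc.2 zero_le_one).image _) ?_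
    rintro _ ⟨u, hu, rfl⟩
    rcases le_total t p with htp | hpt
    · simpa [max_eq_right (sub_nonpos.2 htp)] using hc
    · refine hr _ ⟨?_, ?_⟩
      · have := mul_nonneg hu.1 (le_max_right (t - p) 0); linarith
      · rw [max_eq_left (sub_nonneg.2 hpt)]
        nlinarith [mul_le_mul_of_nonneg_right hu.2 (sub_nonneg.2 hpt)]

/-- A bounded continuous curve has a continuous nondecreasing clock that rests exactly when the
curve does. -/
theorem exists_monotone_clock {F : ℝ → ℂ} (hF : Continuous F) {M : ℝ}
    (hM : ∀ s t, dist (F s) (F t) ≤ M) : ∃ G : ℝ → ℝ, Continuous G ∧ Monotone G ∧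
      ∀ s t, s ≤ t → (G s = G t ↔ ∀ u ∈ Icc s t, F u = F s) := by
  choose h hcont hle h0 hsup using fun n : ℕ =>
    exists_running_sup hF hM (TopologicalSpace.denseSeq ℝ n)
  set q := TopologicalSpace.denseSeq ℝ with hq
  have hM0 : 0 ≤ M := dist_nonneg.trans (hM 0 0)
  have hmono : ∀ n, Monotone (h n) := fun n s t hst =>
    hsup n s _ (h0 n t) fun r hr => hle n t r ⟨hr.1, hr.2.trans hst⟩
  have hbound : ∀ n t, ‖(1 / 2 : ℝ) ^ n * h n t‖ ≤ (1 / 2 : ℝ) ^ n * M := fun n t => by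
    rw [Real.norm_of_nonneg (mul_nonneg (by positivity) (h0 n t))]
    exact mul_le_mul_of_nonneg_left (hsup n t M hM0 fun r _ => hM _ _) (by positivity)
  have hsum : Summable fun n : ℕ => (1 / 2 : ℝ) ^ n * M := summable_geometric_two.mul_right M
  have hsum' : ∀ t, Summable fun n : ℕ => (1 / 2 : ℝ) ^ n * h n t := fun t =>
    Summable.of_norm_bounded hsum fun n => hbound n t
  have hterm : ∀ s t, s ≤ t → (fun n : ℕ => (1 / 2 : ℝ) ^ n * h n s) ≤
      fun n : ℕ => (1 / 2 : ℝ) ^ n * h n t := fun s t hst n =>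
    mul_le_mul_of_nonneg_left (hmono n hst) (by positivity)
  refine ⟨fun t => ∑' n : ℕ, (1 / 2 : ℝ) ^ n * h n t,
    continuous_tsum (fun n => continuous_const.mul (hcont n)) hsum hbound,
    fun s t hst => (hsum' s).tsum_le_tsum (hterm s t hst) (hsum' t), fun s t hst => ⟨?_, ?_⟩⟩
  · intro hG u hu
    have key : ∀ r ∈ Ioo s t, F r = F t := by
      by_contra! hne
      obtain ⟨r, hr, hrne⟩ := hne
      obtain ⟨n, hn, hnt⟩ := (TopologicalSpace.denseRange_denseSeq ℝ).exists_mem_open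
        (isOpen_Ioo.inter (isOpen_ne_fun hF continuous_const)) ⟨r, hr, hrne⟩
      have h1 : h n s ≤ 0 := hsup n s 0 le_rfl fun r hr =>
        absurd (hr.1.trans hr.2) hn.1.not_ge
      have h2 : 0 < h n t := (dist_pos.2 (Ne.symm hnt)).trans_le (hle n t t ⟨hn.2.le, le_rfl⟩)
      exact (Summable.tsum_lt_tsum (i := n) (hterm s t hst)
        (mul_lt_mul_of_pos_left (h1.trans_lt h2) (by positivity)) (hsum' s) (hsum' t)).ne hG
    rcases hst.eq_or_lt with rfl | hlt
    · rw [le_antisymm hu.2 hu.1]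
    have hcl : ∀ r ∈ Icc s t, F r = F t := fun r hr => by
      rw [← closure_Ioo hlt.ne] at hr
      exact closure_minimal (t := {r | F r = F t}) key (isClosed_eq hF continuous_const) hr
    rw [hcl u hu, hcl s ⟨le_rfl, hst⟩]
  · intro hconst
    have : ∀ n, h n s = h n t := fun n => by
      refine le_antisymm (hmono n hst) (hsup n t _ (h0 n s) fun r hr => ?_)
      rcases le_total r s with hrs | hsr
      · exact hle n s r ⟨hr.1, hrs⟩
      · rcases le_total (q n) s with hqs | hsq
        · rw [hconst r ⟨hsr, hr.2⟩]
          exact hle n s s ⟨hqs, le_rfl⟩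
        · rw [hconst r ⟨hsr, hr.2⟩, hconst (q n) ⟨hsq, hr.1.trans hr.2⟩, dist_self]
          exact h0 n s
    simp only [this]

theorem isJordanCurve_of_closed_curve {F : ℝ → ℂ} (hF : Continuous F) {M : ℝ}
    (hM : ∀ s t, dist (F s) (F t) ≤ M) (h01 : F 0 = F 1)
    (hne : ∃ u ∈ Icc (0 : ℝ) 1, F u ≠ F 0)
    (hfib : ∀ s t, 0 ≤ s → s < t → t ≤ 1 → F s = F t → (∀ u ∈ Icc s t, F u = F s) ∨
      ∀ u ∈ Icc 0 s ∪ Icc t 1, F u = F s) : IsJordanCurve (F '' Icc 0 1) := by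
  obtain ⟨G, hG, hGm, hGF⟩ := exists_monotone_clock hF hM
  have hpos : 0 < G 1 - G 0 := by
    refine sub_pos.2 ((hGm zero_le_one).lt_of_ne fun h => ?_)
    obtain ⟨u, hu, huF⟩ := hne
    exact huF ((hGF 0 1 zero_le_one).1 h u hu)
  set θ : ℝ → ℝ := fun t => (G t - G 0) / (G 1 - G 0) with hθ
  have hθc : Continuous θ := by fun_prop
  have hθ01 : ∀ t ∈ Icc (0 : ℝ) 1, θ t ∈ Icc (0 : ℝ) 1 := fun t ht =>
    ⟨div_nonneg (sub_nonneg.2 (hGm ht.1)) hpos.le,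
      (div_le_one hpos).2 (sub_le_sub_right (hGm ht.2) _)⟩
  let a : C(Icc (0 : ℝ) 1, F '' Icc 0 1) :=
    ⟨fun t => ⟨F t, mem_image_of_mem F t.2⟩, by fun_prop⟩
  let e : C(Icc (0 : ℝ) 1, sphere (0 : ℂ) 1) :=
    ⟨fun t => ⟨Complex.exp (2 * Real.pi * Complex.I * θ t), by
      rw [mem_sphere_zero_iff_norm, norm_exp_two_pi_mul_I_mul]⟩, by fun_prop⟩
  have ha : IsQuotientMap a := a.continuous.isClosedMap.isQuotientMap a.continuous (by
    rintro ⟨_, t, ht, rfl⟩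
    exact ⟨⟨t, ht⟩, rfl⟩)
  have he : IsQuotientMap e := e.continuous.isClosedMap.isQuotientMap e.continuous (by
    rintro ⟨z, hz⟩
    obtain ⟨v, hv, hvz⟩ := exists_exp_two_pi_mul_I_mul_eq (mem_sphere_zero_iff_norm.1 hz)
    obtain ⟨t, ht, htv⟩ := intermediate_value_Icc zero_le_one hθc.continuousOn
      (show v ∈ Icc (θ 0) (θ 1) by
        simp only [hθ, sub_self, zero_div, div_self hpos.ne']
        exact Ico_subset_Icc_self hv)
    exact ⟨⟨t, ht⟩, Subtype.ext ((by rw [← htv]; rfl : _ = _).trans hvz)⟩)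
  have key : ∀ s t : ℝ, 0 ≤ s → s < t → t ≤ 1 → (F s = F t ↔ ∃ n : ℤ, θ t = θ s + n) := by
    intro s t hs hst ht
    have hs01 : s ∈ Icc (0 : ℝ) 1 := ⟨hs, hst.le.trans ht⟩
    have ht01 : t ∈ Icc (0 : ℝ) 1 := ⟨hs.trans hst.le, ht⟩
    constructor
    · intro hFst
      rcases hfib s t hs hst ht hFst with h | h
      · exact ⟨0, by simp only [hθ, (hGF s t hst.le).2 h]; simp⟩
      · have h0 : F 0 = F s := h 0 (Or.inl ⟨le_rfl, hs⟩)
        have h1 := (hGF 0 s hs).2 fun u hu => (h u (Or.inl hu)).trans h0.symm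
        have h2 := (hGF t 1 ht).2 fun u hu => (h u (Or.inr hu)).trans hFst
        refine ⟨1, ?_⟩
        simp only [hθ, ← h1, h2, sub_self, zero_div, div_self hpos.ne']
        simp
    · rintro ⟨n, hn⟩
      have hle : θ s ≤ θ t := div_le_div_of_nonneg_right (sub_le_sub_right (hGm hst.le) _) hpos.le
      have hn0 : 0 ≤ n := by
        have : (0 : ℝ) ≤ n := by linarith
        exact_mod_cast this
      have hn1 : n ≤ 1 := by
        have : (n : ℝ) ≤ 1 := by linarith [(hθ01 t ht01).2, (hθ01 s hs01).1]
        exact_mod_cast this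
      have hcases : n = 0 ∨ n = 1 := by omega
      rcases hcases with rfl | rfl
      · have : G s = G t := by
          simp only [hθ, Int.cast_zero, add_zero] at hn
          linarith [(div_left_inj' hpos.ne').1 hn]
        exact ((hGF s t hst.le).1 this t ⟨hst.le, le_rfl⟩).symm
      · have h1 : θ s = 0 ∧ θ t = 1 := by
          push_cast at hn
          constructor <;> linarith [(hθ01 t ht01).2, (hθ01 s hs01).1]
        have h2 : G 0 = G s := by
          have := (div_eq_zero_iff.1 h1.1).resolve_right hpos.ne'
          linarith
        have h3 : G t = G 1 := by
          have := (div_eq_one_iff_eq hpos.ne').1 h1.2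
          linarith
        rw [(hGF 0 s hs).1 h2 s ⟨hs, le_rfl⟩, h01, (hGF t 1 ht).1 h3 1 ⟨ht, le_rfl⟩]
  have hker : Setoid.ker e = Setoid.ker a := by
    refine Setoid.ext fun s t => ?_
    rw [Setoid.ker_def, Setoid.ker_def, Subtype.ext_iff, Subtype.ext_iff]
    change Complex.exp (2 * Real.pi * Complex.I * θ s) =
      Complex.exp (2 * Real.pi * Complex.I * θ t) ↔ F s = F t
    rcases lt_trichotomy (s : ℝ) t with hst | hst | hst
    · rw [key s t s.2.1 hst t.2.2, eq_comm, exp_two_pi_mul_I_mul_eq_iff]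
    · simp [hst]
    · rw [eq_comm (a := F s), key t s t.2.1 hst s.2.2, exp_two_pi_mul_I_mul_eq_iff]
  have h1 := ha.homeomorph
  rw [← hker] at h1
  exact ⟨h1.symm.trans he.homeomorph⟩

theorem IsLoopParam.image_Icc_inter_subset {γ : ℝ → ℂ} {J : Set ℂ} (hγ : IsLoopParam γ J)
    {c d : ℝ} (hc : 0 ≤ c) (hcd : c ≤ d) (hd : d ≤ 1) :
    γ '' Icc c d ∩ γ '' (Icc 0 c ∪ Icc d 1) ⊆ {γ c, γ d} := by
  rintro _ ⟨⟨x, hx, rfl⟩, y, hy, hyx⟩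
  rcases lt_trichotomy x y with hlt | rfl | hlt
  · obtain ⟨rfl, rfl⟩ := hγ.eq_zero_and_eq_one (hc.trans hx.1) hlt
      (hy.elim (fun h => h.2.trans (hcd.trans hd)) fun h => h.2) hyx.symm
    exact Or.inl (by rw [le_antisymm hx.1 hc])
  · rcases hy with hy | hy
    · exact Or.inl (by rw [le_antisymm hy.2 hx.1])
    · exact Or.inr (by rw [le_antisymm hx.2 hy.1]; rfl)
  · obtain ⟨rfl, rfl⟩ := hγ.eq_zero_and_eq_one
      (hy.elim (fun h => h.1) fun h => (hc.trans hcd).trans h.1) hlt (hx.2.trans hd) hyx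
    exact Or.inr (by rw [le_antisymm hd hx.2]; rfl)

/-- A monotone continuous image of a Jordan curve is a point or a Jordan curve. -/
theorem IsLoopParam.image_eq_singleton_or_isJordanCurve {γ : ℝ → ℂ} {Q : Set ℂ}
    (hγ : IsLoopParam γ Q) {f : ℂ → ℂ} (hf : ContinuousOn f Q)
    (hfib : ∀ w, IsPreconnected (Q ∩ f ⁻¹' {w})) :
    f '' Q = {f (γ 0)} ∨ IsJordanCurve (f '' Q) := by
  by_cases hconst : ∀ u ∈ Icc (0 : ℝ) 1, f (γ u) = f (γ 0)
  · refine Or.inl (Subset.antisymm ?_ ?_)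
    · rintro _ ⟨z, hz, rfl⟩
      obtain ⟨u, hu, rfl⟩ := hγ.exists_eq hz
      exact hconst u hu
    · exact singleton_subset_iff.2 (mem_image_of_mem f (hγ.mem ⟨le_rfl, zero_le_one⟩))
  push Not at hconst
  refine Or.inr ?_
  set F : ℝ → ℂ := fun t => f (γ (projIcc 0 1 zero_le_one t)) with hFdef
  have hFeq : ∀ t ∈ Icc (0 : ℝ) 1, F t = f (γ t) := fun t ht => by
    simp only [hFdef, projIcc_of_mem zero_le_one ht]
  have hFQ : ∀ t : ℝ, γ (projIcc 0 1 zero_le_one t) ∈ Q := fun t =>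
    hγ.mem (projIcc (0 : ℝ) 1 zero_le_one t).2
  have hF : Continuous F := hf.comp_continuous
    (hγ.continuous.comp (continuous_subtype_val.comp continuous_projIcc)) hFQ
  have hfQ : IsCompact (f '' Q) := hγ.isCompact.image_of_continuousOn hf
  have h0 : (0 : ℝ) ∈ Icc (0 : ℝ) 1 := ⟨le_rfl, zero_le_one⟩
  have h1 : (1 : ℝ) ∈ Icc (0 : ℝ) 1 := ⟨zero_le_one, le_rfl⟩
  have himg : F '' Icc 0 1 = f '' Q := by
    rw [← hγ.image_eq, image_image]
    exact image_congr hFeq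
  rw [← himg]
  refine isJordanCurve_of_closed_curve hF (M := Metric.diam (f '' Q)) (fun s t =>
    Metric.dist_le_diam_of_mem hfQ.isBounded (mem_image_of_mem f (hFQ s))
      (mem_image_of_mem f (hFQ t))) ?_ ?_ ?_
  · rw [hFeq 0 h0, hFeq 1 h1, hγ.eq_endpoints]
  · obtain ⟨u, hu, hne⟩ := hconst
    exact ⟨u, hu, by rwa [hFeq u hu, hFeq 0 h0]⟩
  intro s t hs hst ht hFst
  have hs01 : s ∈ Icc (0 : ℝ) 1 := ⟨hs, hst.le.trans ht⟩
  have ht01 : t ∈ Icc (0 : ℝ) 1 := ⟨hs.trans hst.le, ht⟩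
  by_contra! hcon
  obtain ⟨⟨u, hu, huF⟩, v, hv, hvF⟩ := hcon
  have hu01 : u ∈ Icc (0 : ℝ) 1 := ⟨hs.trans hu.1, hu.2.trans ht⟩
  have hsep : ∀ c d x y : ℝ, 0 ≤ c → c ≤ d → d ≤ 1 → F c ≠ F s → F d ≠ F s → x ∈ Icc c d →
      y ∈ Icc 0 c ∪ Icc d 1 → F x = F s → F y = F s → False := by
    intro c d x y hc hcd hd hcF hdF hx hy hxF hyF
    have hx01 : x ∈ Icc (0 : ℝ) 1 := ⟨hc.trans hx.1, hx.2.trans hd⟩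
    have hy01 : y ∈ Icc (0 : ℝ) 1 := hy.elim (fun h => ⟨h.1, h.2.trans (hcd.trans hd)⟩)
      fun h => ⟨(hc.trans hcd).trans h.1, h.2⟩
    have hmem : ∀ r ∈ Icc (0 : ℝ) 1, F r = F s → γ r ∈ Q ∩ f ⁻¹' {F s} := fun r hr h =>
      ⟨hγ.mem hr, by rw [mem_preimage, ← hFeq r hr, h]; rfl⟩
    obtain ⟨z, hz, hzcd⟩ := isPreconnected_closed_iff.1 (hfib (F s)) (γ '' Icc c d)
      (γ '' (Icc 0 c ∪ Icc d 1)) (hγ.isCompact_image _ _).isClosed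
      ((isCompact_Icc.union isCompact_Icc).image hγ.continuous).isClosed (fun z hz => by
        obtain ⟨r, hr, rfl⟩ := hγ.exists_eq hz.1
        rw [← image_union]
        refine mem_image_of_mem _ ?_
        rcases le_total r c with h | h
        · exact Or.inr (Or.inl ⟨hr.1, h⟩)
        rcases le_total r d with h' | h'
        · exact Or.inl ⟨h, h'⟩
        · exact Or.inr (Or.inr ⟨h', hr.2⟩))
      ⟨γ x, hmem x hx01 hxF, mem_image_of_mem γ hx⟩ ⟨γ y, hmem y hy01 hyF, mem_image_of_mem γ hy⟩
    rcases hγ.image_Icc_inter_subset hc hcd hd hzcd with rfl | rfl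
    · exact hcF ((hFeq c ⟨hc, hcd.trans hd⟩).trans hz.2)
    · exact hdF ((hFeq d ⟨hc.trans hcd, hd⟩).trans hz.2)
  rcases hv with hv | hv
  · exact hsep v u s t hv.1 (hv.2.trans hu.1) hu01.2 hvF huF ⟨hv.2, hu.1⟩ (Or.inr ⟨hu.2, ht⟩) rfl
      hFst.symm
  · exact hsep u v t s hu01.1 (hu.2.trans hv.1) hv.2 huF hvF ⟨hu.2, hv.1⟩ (Or.inl ⟨hs, hu.1⟩)
      hFst.symm rfl

theorem isPreconnected_inter_preimage {X P : Set ℂ} {f : ℂ → ℂ} (hX : IsCompact X)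
    (hf : ContinuousOn f X) (hP : IsClosed P) (hPc : IsPreconnected P) (hPX : P ⊆ f '' X)
    (hfib : ∀ w ∈ P, IsPreconnected (X ∩ f ⁻¹' {w})) : IsPreconnected (X ∩ f ⁻¹' P) := by
  have hS : IsCompact (X ∩ f ⁻¹' P) := hX.of_isClosed_subset
    (hf.preimage_isClosed_of_isClosed hX.isClosed hP) inter_subset_left
  have himg : ∀ t, IsClosed t → IsClosed (f '' (X ∩ f ⁻¹' P ∩ t)) := fun t ht =>
    ((hS.inter_right ht).image_of_continuousOn
      (hf.mono (inter_subset_left.trans inter_subset_left))).isClosed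
  rw [isPreconnected_closed_iff]
  rintro t t' ht ht' hsub ⟨a, ha, hat⟩ ⟨b, hb, hbt⟩
  obtain ⟨w, hw, ⟨c, ⟨hc, hct⟩, hcw⟩, ⟨d, ⟨hd, hdt⟩, hdw⟩⟩ := isPreconnected_closed_iff.1 hPc
    _ _ (himg t ht) (himg t' ht') (fun w hw => by
      obtain ⟨x, hx, rfl⟩ := hPX hw
      exact (hsub ⟨hx, hw⟩).imp (fun h => ⟨x, ⟨⟨hx, hw⟩, h⟩, rfl⟩) fun h => ⟨x, ⟨⟨hx, hw⟩, h⟩, rfl⟩)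
    ⟨f a, ha.2, ⟨a, ⟨ha, hat⟩, rfl⟩⟩ ⟨f b, hb.2, ⟨b, ⟨hb, hbt⟩, rfl⟩⟩
  have hfibS : X ∩ f ⁻¹' {w} ⊆ X ∩ f ⁻¹' P := fun z hz => ⟨hz.1, by
    rw [mem_preimage, show f z = w from hz.2]; exact hw⟩
  obtain ⟨z, hz, hzt⟩ := isPreconnected_closed_iff.1 (hfib w hw) t t' ht ht' (hfibS.trans hsub)
    ⟨c, ⟨hc.1, hcw⟩, hct⟩ ⟨d, ⟨hd.1, hdw⟩, hdt⟩
  exact ⟨z, hfibS hz, hzt⟩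

theorem locallyConnectedSpace_image {Q : Set ℂ} {f : ℂ → ℂ} (hQ : IsCompact Q)
    (hf : ContinuousOn f Q) [LocallyConnectedSpace Q] : LocallyConnectedSpace ↥(f '' Q) := by
  have := isCompact_iff_compactSpace.1 hQ
  have hc : Continuous (mapsTo_image f Q).restrict := hf.mapsToRestrict (mapsTo_image f Q)
  exact (hc.isClosedMap.isQuotientMap hc
    (by rintro ⟨_, z, hz, rfl⟩; exact ⟨⟨z, hz⟩, rfl⟩)).isCoinducing.locallyConnectedSpace

namespace IsBoundaryExtension

variable {f ψ : ℂ → ℂ} {D Ω : Set ℂ}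

theorem isGeneralizedJordanDomain_target (h : IsBoundaryExtension f ψ D Ω)
    (hD : IsGeneralizedJordanDomain D) (hΩ : IsPlanarDomain Ω) (hΩb : Bornology.IsBounded Ω)
    (hmono : ∀ w ∈ closure Ω, IsPreconnected (closure D ∩ f ⁻¹' {w})) :
    IsGeneralizedJordanDomain Ω := by
  obtain ⟨-, -, ⟨hX, hlc, hfin⟩, hcomp⟩ := hD
  have hf := h.continuousOn_frontier
  have hK : IsCompact (frontier Ω) := h.image_frontier ▸ hX.image_of_continuousOn hf
  have hfib : ∀ w ∈ frontier Ω, IsPreconnected (frontier D ∩ f ⁻¹' {w}) := fun w hw => by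
    have : frontier D ∩ f ⁻¹' {w} = closure D ∩ f ⁻¹' {w} := by
      refine Subset.antisymm (inter_subset_inter_left _ frontier_subset_closure) ?_
      rintro z ⟨hz, rfl⟩
      exact ⟨h.mem_frontier_of_apply_mem hz hw, rfl⟩
    rw [this]; exact hmono w (frontier_subset_closure hw)
  have hQcl : ∀ x, IsCompact (connectedComponentIn (frontier D) x) := fun x =>
    hX.of_isClosed_subset (isClosed_connectedComponentIn hX.isClosed x)
      (connectedComponentIn_subset _ _)
  have hfQ : ∀ x, ContinuousOn f (connectedComponentIn (frontier D) x) := fun x =>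
    hf.mono (connectedComponentIn_subset _ _)
  have himage : ∀ x ∈ frontier D, f '' connectedComponentIn (frontier D) x =
      connectedComponentIn (frontier Ω) (f x) := by
    intro x hx
    have hfx := h.mapsTo_frontier hx
    refine Subset.antisymm ?_ ?_
    · exact (isPreconnected_connectedComponentIn.image f (hfQ x)).subset_connectedComponentIn
        (mem_image_of_mem f (mem_connectedComponentIn hx))
        ((image_mono (connectedComponentIn_subset _ _)).trans h.mapsTo_frontier.image_subset)
    · set P := connectedComponentIn (frontier Ω) (f x) with hP
      have hPs : P ⊆ frontier Ω := connectedComponentIn_subset _ _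
      have hpre := (isPreconnected_inter_preimage hX hf
        (isClosed_connectedComponentIn hK.isClosed (f x)) isPreconnected_connectedComponentIn
        (hPs.trans h.surjOn_frontier) fun w hw => hfib w (hPs hw)).subset_connectedComponentIn
        (x := x) ⟨hx, mem_connectedComponentIn hfx⟩ inter_subset_left
      intro w hw
      obtain ⟨z, hz, rfl⟩ := h.surjOn_frontier (hPs hw)
      exact ⟨z, hpre ⟨hz, hw⟩, rfl⟩
  have hlift : ∀ w ∈ frontier Ω, ∃ x ∈ frontier D, connectedComponentIn (frontier Ω) w =
      f '' connectedComponentIn (frontier D) x := fun w hw => by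
    obtain ⟨x, hx, rfl⟩ := h.surjOn_frontier hw
    exact ⟨x, hx, (himage x hx).symm⟩
  refine ⟨hΩ, hΩb, ⟨hK, fun w hw => ?_, fun C hC => ?_⟩, fun w hw => ?_⟩
  · obtain ⟨x, hx, hxw⟩ := hlift w hw
    rw [hxw]
    have := hlc x hx
    exact locallyConnectedSpace_image (hQcl x) (hfQ x)
  · obtain ⟨δ, hδ, hδC⟩ := Metric.uniformContinuousOn_iff.1
      (hX.uniformContinuousOn_of_continuous hf) C hC
    refine ((hfin (δ / 2) (half_pos hδ)).image (image f)).subset ?_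
    rintro _ ⟨⟨w, hw, rfl⟩, hdiam⟩
    obtain ⟨x, hx, hxw⟩ := hlift w hw
    refine ⟨_, ⟨⟨x, hx, rfl⟩, ?_⟩, hxw.symm⟩
    by_contra! hle
    rw [hxw] at hdiam
    refine hdiam.not_ge (Metric.diam_le_of_forall_dist_le hC.le ?_)
    rintro _ ⟨z, hz, rfl⟩ _ ⟨z', hz', rfl⟩
    refine (hδC z (connectedComponentIn_subset _ _ hz) z' (connectedComponentIn_subset _ _ hz')
      ?_).le
    exact ((Metric.dist_le_diam_of_mem (hQcl x).isBounded hz hz').trans hle).trans_lt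
      (half_lt_self hδ)
  · obtain ⟨x, hx, rfl⟩ := h.surjOn_frontier hw
    rw [← himage x hx]
    rcases hcomp x hx with hQ | hQ
    · left; rw [hQ, image_singleton]
    obtain ⟨γ, hγ, hγ0⟩ := hQ.exists_isLoopParam (mem_connectedComponentIn hx)
    rw [← hγ0]
    rw [← hγ0] at hγ
    refine hγ.image_eq_singleton_or_isJordanCurve (hfQ _) fun v => ?_
    rcases (connectedComponentIn (frontier D) (γ 0) ∩ f ⁻¹' {v}).eq_empty_or_nonempty with
      he | ⟨z, hz, hzv⟩
    · rw [he]; exact isPreconnected_empty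
    have hzD := connectedComponentIn_subset _ _ hz
    have hv : IsPreconnected (frontier D ∩ f ⁻¹' {v}) :=
      hfib v ((hzv : f z = v) ▸ h.mapsTo_frontier hzD)
    have : connectedComponentIn (frontier D) (γ 0) ∩ f ⁻¹' {v} = frontier D ∩ f ⁻¹' {v} := by
      refine Subset.antisymm (inter_subset_inter_left _ (connectedComponentIn_subset _ _)) ?_
      rw [connectedComponentIn_eq hz]
      exact fun y hy => ⟨hv.subset_connectedComponentIn ⟨hzD, hzv⟩ inter_subset_left hy, hy.2⟩
    rw [this]
    exact hv

end IsBoundaryExtension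

/-- Boundary behaviour of the continuous extension: it is non-alternating on every
boundary component, and it is monotone iff the image domain is a generalized Jordan
domain. -/
theorem stmt_11 (D Ω : Set ℂ) (φ φb : ℂ → ℂ)
    (hD : IsGeneralizedJordanDomain D)
    (hΩ : IsPlanarDomain Ω) (hΩb : Bornology.IsBounded Ω)
    (hφ : IsHomeoOnto φ D Ω)
    (hext : ExtendsContinuously φ φb D Ω) :
    (∀ x ∈ frontier D,
      NonAlternatingOn φb (connectedComponentIn (frontier D) x)
        (φb '' connectedComponentIn (frontier D) x)) ∧
    ((∀ w ∈ closure Ω, IsPreconnected (closure D ∩ φb ⁻¹' {w})) ↔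
      IsGeneralizedJordanDomain Ω) := by
  obtain ⟨-, hbij, ψ, hψc, hinv⟩ := hφ
  obtain ⟨hc, heq, -⟩ := hext
  have hmaps : MapsTo φb D Ω := hbij.mapsTo.congr heq.symm
  have hmaps' : MapsTo ψ Ω D := by
    intro w hw
    obtain ⟨z, hz, rfl⟩ := hbij.surjOn hw
    rwa [hinv.1 hz]
  have h : IsBoundaryExtension φb ψ D Ω :=
    { isOpen_source := hD.1.2.1
      isOpen_target := hΩ.2.1
      isBounded_source := hD.2.1
      continuousOn := hc
      mapsTo := hmaps
      continuousOn_inv := hψc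
      mapsTo_inv := hmaps'
      left_inv := fun z hz => by rw [heq hz]; exact hinv.1 hz
      right_inv := fun w hw => by rw [heq (hmaps' hw)]; exact hinv.2 hw }
  exact ⟨fun x hx => h.nonAlternatingOn hD hΩ.2.2.isPreconnected hx,
    h.isGeneralizedJordanDomain_target hD hΩ hΩb, fun hG w hw => h.isPreconnected_fiber hG hw⟩
end
end

section
/- A bounded domain Ω ⊆ ℂ has property S if and only if Ω is finitely connected at the boundary. -/
open Set Metric Filter MeasureTheory Topology

noncomputable section

/-- A finite union of connected sets has finitely many connected components. -/
theorem finite_components_of_eq_iUnion {X ι : Type*} [TopologicalSpace X] [Finite ι]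
    {V : Set X} {C : ι → Set X} (hC : ∀ i, IsConnected (C i)) (hV : (⋃ i, C i) = V) :
    {Q : Set X | ∃ y ∈ V, Q = connectedComponentIn V y}.Finite := by
  choose p hp using fun i => (hC i).nonempty
  refine (Set.finite_range fun i => connectedComponentIn V (p i)).subset ?_
  rintro Q ⟨y, hy, rfl⟩
  obtain ⟨i, hi⟩ := mem_iUnion.1 (hV ▸ hy)
  have hCV : C i ⊆ V := hV ▸ subset_iUnion C i
  exact ⟨i, connectedComponentIn_eq
    ((hC i).isPreconnected.subset_connectedComponentIn (hp i) hCV hi)⟩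

theorem PropertyS.finitelyConnectedAt {Ω : Set ℂ} (hS : PropertyS Ω) (ho : IsOpen Ω)
    (hb : Bornology.IsBounded Ω) (x : ℂ) : FinitelyConnectedAt Ω x := by
  intro r hr
  obtain ⟨k, N, hN, hNΩ⟩ := hS r hr
  have hsub : ∀ i, N i ⊆ Ω := fun i => hNΩ ▸ subset_iUnion N i
  choose p hp using fun i => (hN i).1.nonempty
  let F := {i : Fin k // x ∈ closure (N i)}
  have hball : ∀ i : F, N i ⊆ ball x r := by
    intro i y hy
    have h := dist_le_diam_of_mem (hb.subset (hsub i)).closure (subset_closure hy) i.2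
    rw [diam_closure] at h
    exact mem_ball.2 (h.trans_lt (hN i).2)
  let C : F → Set ℂ := fun i => connectedComponentIn (ball x r ∩ Ω) (p i)
  have hmem : ∀ i : F, p i ∈ ball x r ∩ Ω := fun i => ⟨hball i (hp i), hsub i (hp i)⟩
  have hCsub : ∀ i, C i ⊆ ball x r ∩ Ω := fun i => connectedComponentIn_subset _ _
  have hNC : ∀ i : F, N i ⊆ C i := fun i =>
    (hN i).1.isPreconnected.subset_connectedComponentIn (hp i)
      (subset_inter (hball i) (hsub i))
  let W : Set ℂ := (⋃ i : {i : Fin k // x ∉ closure (N i)}, closure (N i))ᶜ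
  have hW : IsOpen W := (isClosed_iUnion_of_finite fun i => isClosed_closure).isOpen_compl
  have hxW : x ∈ W := by
    intro h
    obtain ⟨i, hi⟩ := mem_iUnion.1 h
    exact i.2 hi
  have hUΩ : (⋃ i, C i) = ((⋃ i, C i) ∪ (W ∩ ball x r)) ∩ Ω := by
    ext y
    constructor
    · intro hy
      obtain ⟨i, hi⟩ := mem_iUnion.1 hy
      exact ⟨Or.inl hy, (hCsub i hi).2⟩
    · rintro ⟨hy | hy, hyΩ⟩
      · exact hy
      · rw [← hNΩ] at hyΩ
        obtain ⟨i, hi⟩ := mem_iUnion.1 hyΩ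
        by_cases hx : x ∈ closure (N i)
        · exact mem_iUnion.2 ⟨⟨i, hx⟩, hNC ⟨i, hx⟩ hi⟩
        · exact (hy.1 (mem_iUnion.2 ⟨⟨i, hx⟩, subset_closure hi⟩)).elim
  refine ⟨(⋃ i, C i) ∪ (W ∩ ball x r), ?_, Or.inr ⟨hxW, mem_ball_self hr⟩, ?_, ?_⟩
  · exact (isOpen_iUnion fun i => (isOpen_ball.inter ho).connectedComponentIn).union
      (hW.inter isOpen_ball)
  · exact union_subset (iUnion_subset fun i => (hCsub i).trans inter_subset_left)
      inter_subset_right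
  · exact finite_components_of_eq_iUnion
      (fun i => isConnected_connectedComponentIn_iff.2 (hmem i)) hUΩ

theorem IsOpen.finitelyConnectedAt {Ω : Set ℂ} (ho : IsOpen Ω) {x : ℂ} (hx : x ∈ Ω) :
    FinitelyConnectedAt Ω x := by
  intro r hr
  obtain ⟨s, hs, hsΩ⟩ := Metric.isOpen_iff.1 ho x hx
  have hpos : 0 < min s r := lt_min hs hr
  refine ⟨ball x (min s r), isOpen_ball, mem_ball_self hpos,
    ball_subset_ball (min_le_right _ _), ?_⟩
  refine finite_components_of_eq_iUnion (ι := Unit) (C := fun _ => ball x (min s r))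
    (fun _ => Metric.isConnected_ball hpos) ?_
  rw [iUnion_const, inter_eq_left.2 ((ball_subset_ball (min_le_left _ _)).trans hsΩ)]

theorem propertyS_of_finitelyConnectedAt_closure {Ω : Set ℂ} (hb : Bornology.IsBounded Ω)
    (h : ∀ x ∈ closure Ω, FinitelyConnectedAt Ω x) : PropertyS Ω := by
  intro ε hε
  have hr : 0 < ε / 4 := by positivity
  choose! U hUo hxU hUb hUfin using fun x hx => h x hx (ε / 4) hr
  obtain ⟨t, ht, hcover⟩ := hb.isCompact_closure.elim_nhds_subcover U
    fun x hx => (hUo x hx).mem_nhds (hxU x hx)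
  let S : Set (Set ℂ) :=
    ⋃ x ∈ t, {Q | ∃ y ∈ U x ∩ Ω, Q = connectedComponentIn (U x ∩ Ω) y}
  have hS : S.Finite := t.finite_toSet.biUnion fun x hx => hUfin x (ht x hx)
  obtain ⟨k, N, -, hN⟩ := hS.fin_param
  have hmem : ∀ i, ∃ x ∈ t, ∃ y ∈ U x ∩ Ω, N i = connectedComponentIn (U x ∩ Ω) y := by
    intro i
    have hi : N i ∈ S := hN ▸ mem_range_self i
    simpa [S] using hi
  refine ⟨k, N, fun i => ?_, Subset.antisymm (iUnion_subset fun i => ?_) fun y hy => ?_⟩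
  · obtain ⟨x, hx, y, hy, hi⟩ := hmem i
    rw [hi]
    refine ⟨isConnected_connectedComponentIn_iff.2 hy, ?_⟩
    have hsub : connectedComponentIn (U x ∩ Ω) y ⊆ ball x (ε / 4) :=
      (connectedComponentIn_subset _ _).trans (inter_subset_left.trans (hUb x (ht x hx)))
    have h1 := diam_mono hsub isBounded_ball
    have h2 := diam_ball (x := x) hr.le
    linarith
  · obtain ⟨x, -, y, -, hi⟩ := hmem i
    rw [hi]
    exact (connectedComponentIn_subset _ _).trans inter_subset_right
  · obtain ⟨x, hx, hyx⟩ := mem_iUnion₂.1 (hcover (subset_closure hy))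
    have hQ : connectedComponentIn (U x ∩ Ω) y ∈ S :=
      mem_iUnion₂.2 ⟨x, hx, y, ⟨hyx, hy⟩, rfl⟩
    obtain ⟨i, hi⟩ : ∃ i, N i = connectedComponentIn (U x ∩ Ω) y := by
      rwa [← hN] at hQ
    exact mem_iUnion.2 ⟨i, hi ▸ mem_connectedComponentIn ⟨hyx, hy⟩⟩

/-- A bounded domain has property S iff it is finitely connected at the boundary. -/
theorem stmt_12 (Ω : Set ℂ) (hΩ : IsPlanarDomain Ω) (hb : Bornology.IsBounded Ω) :
    PropertyS Ω ↔ ∀ x ∈ frontier Ω, FinitelyConnectedAt Ω x := by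
  refine ⟨fun hS x _ => hS.finitelyConnectedAt hΩ.2.1 hb x, fun h => ?_⟩
  refine propertyS_of_finitelyConnectedAt_closure hb fun x hx => ?_
  by_cases hxΩ : x ∈ Ω
  · exact hΩ.2.1.finitelyConnectedAt hxΩ
  · exact h x (hΩ.2.1.frontier_eq ▸ ⟨hx, hxΩ⟩)
end
end
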